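/- arXiv:q-alg/9705024 — 15 statements merged into one kernel-verified Lean document; each statement's English description precedes it below -/
import Mathlib

section
/- The matrix R₂,₂ satisfies the constant quantum Yang–Baxter equation R₁₂ R₁₃ R₂₃ = R₂₃ R₁₃ R₁₂ as an identity of 8×8 complex matrices, where R₁₂ = R₂,₂ ⊗ I₂, R₂₃ = I₂ ⊗ R₂,₂, and R₁₃ = (I₂ ⊗ P)(R₂,₂ ⊗ I₂)(I₂ ⊗ P), with P the 4×4 permutation matrix exchanging the two tensor factors of ℂ²⊗ℂ² (P(u⊗v) = v⊗u) and ⊗ denoting the Kronecker product. -/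
open Matrix Kronecker

/-- The matrix `R₂,₂`, with rows and columns indexed by the ordered basis
`e₁⊗e₁, e₁⊗e₂, e₂⊗e₁, e₂⊗e₂` of `ℂ²⊗ℂ²`, i.e. by pairs `(0,0), (0,1), (1,0), (1,1)`. -/
noncomputable def R22 (r q : ℂ) : Matrix (Fin 2 × Fin 2) (Fin 2 × Fin 2) ℂ :=
  fun p p' =>
    if p = ((0 : Fin 2), (0 : Fin 2)) ∧ p' = (0, 0) then r
    else if p = ((0 : Fin 2), (1 : Fin 2)) ∧ p' = (0, 1) then 1
    else if p = ((0 : Fin 2), (1 : Fin 2)) ∧ p' = (1, 0) then r * (1 - q⁻¹)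
    else if p = ((1 : Fin 2), (0 : Fin 2)) ∧ p' = (1, 0) then r ^ 2 * q⁻¹
    else if p = ((1 : Fin 2), (1 : Fin 2)) ∧ p' = (1, 1) then -r * q⁻¹
    else 0

/-- The 4×4 permutation matrix exchanging the two tensor factors of `ℂ²⊗ℂ²`. -/
def Pswap : Matrix (Fin 2 × Fin 2) (Fin 2 × Fin 2) ℂ :=
  fun p p' => if p.1 = p'.2 ∧ p.2 = p'.1 then 1 else 0

/-- `R₂,₂` satisfies the constant quantum Yang–Baxter equation
`R₁₂ R₁₃ R₂₃ = R₂₃ R₁₃ R₁₂` as 8×8 complex matrices. -/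
theorem R22_yangBaxter (r q : ℂ) (hr : r ≠ 0) (hq : q ≠ 0) :
    let R := R22 r q
    let R12 : Matrix (Fin 2 × Fin 2 × Fin 2) (Fin 2 × Fin 2 × Fin 2) ℂ :=
      Matrix.reindex (Equiv.prodAssoc (Fin 2) (Fin 2) (Fin 2))
        (Equiv.prodAssoc (Fin 2) (Fin 2) (Fin 2)) (R ⊗ₖ (1 : Matrix (Fin 2) (Fin 2) ℂ))
    let R23 : Matrix (Fin 2 × Fin 2 × Fin 2) (Fin 2 × Fin 2 × Fin 2) ℂ :=
      (1 : Matrix (Fin 2) (Fin 2) ℂ) ⊗ₖ R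
    let IP : Matrix (Fin 2 × Fin 2 × Fin 2) (Fin 2 × Fin 2 × Fin 2) ℂ :=
      (1 : Matrix (Fin 2) (Fin 2) ℂ) ⊗ₖ Pswap
    let R13 := IP * R12 * IP
    R12 * R13 * R23 = R23 * R13 * R12 := by
  intro R R12 R23 IP R13
  have h12 : ∀ a b c a' b' c', R12 (a, b, c) (a', b', c')
      = R22 r q (a, b) (a', b') * (if c = c' then 1 else 0) := by
    intro a b c a' b' c'
    simp [R12, R, Matrix.one_apply]
  have h23 : ∀ a b c a' b' c', R23 (a, b, c) (a', b', c')
      = (if a = a' then 1 else 0) * R22 r q (b, c) (b', c') := by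
    intro a b c a' b' c'
    simp [R23, R, Matrix.one_apply]
  have hIP : ∀ a b c a' b' c', IP (a, b, c) (a', b', c')
      = if a = a' ∧ b = c' ∧ c = b' then 1 else 0 := by
    intro a b c a' b' c'
    simp [IP, Pswap, Matrix.one_apply, ite_and]
    split_ifs <;> rfl
  have h13 : ∀ a b c a' b' c', R13 (a, b, c) (a', b', c')
      = R22 r q (a, c) (a', c') * (if b = b' then 1 else 0) := by
    intro a b c a' b' c'
    simp only [R13, Matrix.mul_apply, Fintype.sum_prod_type, h12, hIP]
    simp [ite_and]
  ext ⟨a, b, c⟩ ⟨a', b', c'⟩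
  simp only [Matrix.mul_apply, Fintype.sum_prod_type, h12, h13, h23, Fin.sum_univ_two]
  clear_value R12 R13 R23 IP
  fin_cases a <;> fin_cases b <;> fin_cases c <;> fin_cases a' <;> fin_cases b' <;>
    fin_cases c' <;> simp [R22] <;> ring
end

section
/- The matrix R₁,₂ satisfies the constant quantum Yang–Baxter equation R₁₂ R₁₃ R₂₃ = R₂₃ R₁₃ R₁₂ as an identity of 8×8 complex matrices, where R₁₂ = R₁,₂ ⊗ I₂, R₂₃ = I₂ ⊗ R₁,₂, and R₁₃ = (I₂ ⊗ P)(R₁,₂ ⊗ I₂)(I₂ ⊗ P), with P the 4×4 permutation matrix exchanging the two tensor factors of ℂ²⊗ℂ² (P(u⊗v) = v⊗u) and ⊗ denoting the Kronecker product. -/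
open Matrix Kronecker

/-- The matrix `R₁,₂`, with rows and columns indexed by the ordered basis
`e₁⊗e₁, e₁⊗e₂, e₂⊗e₁, e₂⊗e₂` of `ℂ²⊗ℂ²`, i.e. by pairs `(0,0), (0,1), (1,0), (1,1)`. -/
noncomputable def R12mat (r q : ℂ) : Matrix (Fin 2 × Fin 2) (Fin 2 × Fin 2) ℂ :=
  fun p p' =>
    if p = ((0 : Fin 2), (0 : Fin 2)) ∧ p' = (0, 0) then 1
    else if p = ((0 : Fin 2), (0 : Fin 2)) ∧ p' = (1, 1) then r
    else if p = ((0 : Fin 2), (1 : Fin 2)) ∧ p' = (0, 1) then 1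
    else if p = ((0 : Fin 2), (1 : Fin 2)) ∧ p' = (1, 0) then 1 - q⁻¹
    else if p = ((1 : Fin 2), (0 : Fin 2)) ∧ p' = (1, 0) then q⁻¹
    else if p = ((1 : Fin 2), (1 : Fin 2)) ∧ p' = (1, 1) then -q⁻¹
    else 0

set_option maxHeartbeats 4000000 in
/-- `R₁,₂` satisfies the constant quantum Yang–Baxter equation
`R₁₂ R₁₃ R₂₃ = R₂₃ R₁₃ R₁₂` as 8×8 complex matrices. -/
theorem R12mat_yangBaxter (r q : ℂ) (hq : q ≠ 0) :
    let R := R12mat r q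
    let R12 : Matrix (Fin 2 × Fin 2 × Fin 2) (Fin 2 × Fin 2 × Fin 2) ℂ :=
      Matrix.reindex (Equiv.prodAssoc (Fin 2) (Fin 2) (Fin 2))
        (Equiv.prodAssoc (Fin 2) (Fin 2) (Fin 2)) (R ⊗ₖ (1 : Matrix (Fin 2) (Fin 2) ℂ))
    let R23 : Matrix (Fin 2 × Fin 2 × Fin 2) (Fin 2 × Fin 2 × Fin 2) ℂ :=
      (1 : Matrix (Fin 2) (Fin 2) ℂ) ⊗ₖ R
    let IP : Matrix (Fin 2 × Fin 2 × Fin 2) (Fin 2 × Fin 2 × Fin 2) ℂ :=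
      (1 : Matrix (Fin 2) (Fin 2) ℂ) ⊗ₖ Pswap
    let R13 := IP * R12 * IP
    R12 * R13 * R23 = R23 * R13 * R12 := by
  intro R R12 R23 IP R13
  have h13 : ∀ a b c d e f, R13 (a, b, c) (d, e, f) = if b = e then R (a, c) (d, f) else 0 := by
    intro a b c d e f
    simp only [R13, IP, R12, Matrix.mul_apply, Fintype.sum_prod_type, Fin.sum_univ_two,
      Matrix.reindex_apply, Matrix.submatrix_apply, Matrix.kroneckerMap_apply, Matrix.one_apply,
      Equiv.prodAssoc_symm_apply, Pswap]
    generalize R = M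
    fin_cases a <;> fin_cases b <;> fin_cases c <;> fin_cases d <;> fin_cases e <;>
      fin_cases f <;> simp
  have h12 : ∀ a b c d e f, R12 (a, b, c) (d, e, f) = if c = f then R (a, b) (d, e) else 0 := by
    intro a b c d e f
    simp [R12, Matrix.one_apply]
  have h23 : ∀ a b c d e f, R23 (a, b, c) (d, e, f) = if a = d then R (b, c) (e, f) else 0 := by
    intro a b c d e f
    simp [R23, Matrix.one_apply]
  clear_value R13 R12 R23
  ext ⟨a, b, c⟩ ⟨d, e, f⟩
  simp only [Matrix.mul_apply, Fintype.sum_prod_type, Fin.sum_univ_two, h12, h13, h23]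
  fin_cases a <;> fin_cases b <;> fin_cases c <;> fin_cases d <;> fin_cases e <;>
    fin_cases f <;> simp [R, R12mat] <;> ring
end

section
/- The FRT relation R₁,₂ T₁ T₂ = T₂ T₁ R₁,₂ (an equality of 4×4 matrices over 𝔸) holds if and only if the elements a,b,c,d satisfy the A₁,₂ relations: ba − ab + r·q·dc = 0, ca − q·ac = 0, bd + db − r·q·ac = 0, cd + q·dc = 0, ad − da − (1−q)·bc = 0, cb − q·bc = 0, (1+q)·b² − r·q·(a²−d²) = 0, c² = 0. -/
open Matrix Kronecker

/-- The FRT relation `R₁,₂ T₁ T₂ = T₂ T₁ R₁,₂` holds iff `a,b,c,d` satisfy the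
`A₁,₂` relations. -/
theorem frt_R12_iff (r q : ℂ) (hr : r ≠ 0) (hq : q ≠ 0) (hq1 : q ≠ 1) (hqm1 : q ≠ -1)
    {𝔸 : Type*} [Ring 𝔸] [Algebra ℂ 𝔸] (a b c d : 𝔸) :
    (let T : Matrix (Fin 2) (Fin 2) 𝔸 := !![a, b; c, d]
     let T₁ := T ⊗ₖ (1 : Matrix (Fin 2) (Fin 2) 𝔸)
     let T₂ := (1 : Matrix (Fin 2) (Fin 2) 𝔸) ⊗ₖ T
     (R12mat r q).map (algebraMap ℂ 𝔸) * (T₁ * T₂)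
       = (T₂ * T₁) * (R12mat r q).map (algebraMap ℂ 𝔸)) ↔
    (b * a - a * b + (r * q) • (d * c) = 0 ∧
     c * a - q • (a * c) = 0 ∧
     b * d + d * b - (r * q) • (a * c) = 0 ∧
     c * d + q • (d * c) = 0 ∧
     a * d - d * a - (1 - q) • (b * c) = 0 ∧
     c * b - q • (b * c) = 0 ∧
     (1 + q) • (b ^ 2) - (r * q) • (a ^ 2 - d ^ 2) = 0 ∧
     c ^ 2 = 0) := by
  have key : ((R12mat r q).map (algebraMap ℂ 𝔸) *
        ((!![a, b; c, d] ⊗ₖ (1 : Matrix (Fin 2) (Fin 2) 𝔸)) *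
          ((1 : Matrix (Fin 2) (Fin 2) 𝔸) ⊗ₖ !![a, b; c, d]))
       = (((1 : Matrix (Fin 2) (Fin 2) 𝔸) ⊗ₖ !![a, b; c, d]) *
          (!![a, b; c, d] ⊗ₖ (1 : Matrix (Fin 2) (Fin 2) 𝔸))) *
          (R12mat r q).map (algebraMap ℂ 𝔸)) ↔
      ((a * a + r • (c * c) = a * a ∧ a * b + r • (c * d) = b * a ∧
        b * a + r • (d * c) = (1 - q⁻¹) • (b * a) + q⁻¹ • (a * b) ∧
        b * b + r • (d * d) = r • (a * a) - q⁻¹ • (b * b)) ∧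
       (a * c + (1 - q⁻¹) • (c * a) = c * a ∧ a * d + (1 - q⁻¹) • (c * b) = d * a ∧
        b * c + (1 - q⁻¹) • (d * a) = (1 - q⁻¹) • (d * a) + q⁻¹ • (c * b) ∧
        b * d + (1 - q⁻¹) • (d * b) = r • (c * a) - q⁻¹ • (d * b)) ∧
       (q⁻¹ • (c * a) = a * c ∧ q⁻¹ • (c * b) = b * c ∧
        q⁻¹ • (d * a) = (1 - q⁻¹) • (b * c) + q⁻¹ • (a * d) ∧
        q⁻¹ • (d * b) = r • (a * c) - q⁻¹ • (b * d)) ∧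
       (-(q⁻¹ • (c * c)) = c * c ∧ -(q⁻¹ • (c * d)) = d * c ∧
        -(q⁻¹ • (d * c)) = (1 - q⁻¹) • (d * c) + q⁻¹ • (c * d) ∧
        -(q⁻¹ • (d * d)) = r • (c * c) - q⁻¹ • (d * d))) := by
    have comm : ∀ (z : ℂ) (x : 𝔸), x * algebraMap ℂ 𝔸 z = z • x := fun z x => by
      rw [Algebra.smul_def, Algebra.commutes]
    rw [← Matrix.ext_iff]
    simp only [Prod.forall, Fin.forall_fin_two, Matrix.mul_apply, Fintype.sum_prod_type,
      Fin.sum_univ_two, Matrix.map_apply, R12mat, Matrix.kroneckerMap_apply]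
    simp [← Algebra.smul_def, comm, -map_sub, -map_add, -map_inv₀, sub_eq_add_neg, and_assoc]
  show _ ↔ _
  refine key.trans ⟨?_, ?_⟩
  · rintro ⟨⟨e1, e2, e3, e4⟩, ⟨e5, e6, e7, e8⟩, ⟨e9, e10, e11, e12⟩, ⟨e13, e14, e15, e16⟩⟩
    refine ⟨?_, ?_, ?_, ?_, ?_, ?_, ?_, ?_⟩
    · linear_combination (norm := ((try simp only [pow_two]); match_scalars <;> (try field_simp) <;> (try ring))) q • e3
    · linear_combination (norm := ((try simp only [pow_two]); match_scalars <;> (try field_simp) <;> (try ring))) q • e9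
    · linear_combination (norm := ((try simp only [pow_two]); match_scalars <;> (try field_simp) <;> (try ring))) q • e12
    · linear_combination (norm := ((try simp only [pow_two]); match_scalars <;> (try field_simp) <;> (try ring))) (-q) • e14
    · linear_combination (norm := ((try simp only [pow_two]); match_scalars <;> (try field_simp) <;> (try ring))) (-q) • e11
    · linear_combination (norm := ((try simp only [pow_two]); match_scalars <;> (try field_simp) <;> (try ring))) q • e10
    · linear_combination (norm := ((try simp only [pow_two]); match_scalars <;> (try field_simp) <;> (try ring))) q • e4
    · linear_combination (norm := ((try simp only [pow_two]); match_scalars <;> (try field_simp) <;> (try ring))) r⁻¹ • e1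
  · rintro ⟨h1, h2, h3, h4, h5, h6, h7, h8⟩
    refine ⟨⟨?_, ?_, ?_, ?_⟩, ⟨?_, ?_, ?_, ?_⟩, ⟨?_, ?_, ?_, ?_⟩, ⟨?_, ?_, ?_, ?_⟩⟩
    · linear_combination (norm := ((try simp only [pow_two]); match_scalars <;> (try field_simp) <;> (try ring))) r • h8
    · linear_combination (norm := ((try simp only [pow_two]); match_scalars <;> (try field_simp) <;> (try ring))) (-1 : ℂ) • h1 + r • h4
    · linear_combination (norm := ((try simp only [pow_two]); match_scalars <;> (try field_simp) <;> (try ring))) q⁻¹ • h1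
    · linear_combination (norm := ((try simp only [pow_two]); match_scalars <;> (try field_simp) <;> (try ring))) q⁻¹ • h7
    · linear_combination (norm := ((try simp only [pow_two]); match_scalars <;> (try field_simp) <;> (try ring))) (-q⁻¹) • h2
    · linear_combination (norm := ((try simp only [pow_two]); match_scalars <;> (try field_simp) <;> (try ring))) h5 + (1 - q⁻¹) • h6
    · linear_combination (norm := ((try simp only [pow_two]); match_scalars <;> (try field_simp) <;> (try ring))) (-q⁻¹) • h6
    · linear_combination (norm := ((try simp only [pow_two]); match_scalars <;> (try field_simp) <;> (try ring))) h3 - r • h2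
    · linear_combination (norm := ((try simp only [pow_two]); match_scalars <;> (try field_simp) <;> (try ring))) q⁻¹ • h2
    · linear_combination (norm := ((try simp only [pow_two]); match_scalars <;> (try field_simp) <;> (try ring))) q⁻¹ • h6
    · linear_combination (norm := ((try simp only [pow_two]); match_scalars <;> (try field_simp) <;> (try ring))) (-q⁻¹) • h5
    · linear_combination (norm := ((try simp only [pow_two]); match_scalars <;> (try field_simp) <;> (try ring))) q⁻¹ • h3
    · linear_combination (norm := ((try simp only [pow_two]); match_scalars <;> (try field_simp) <;> (try ring))) (-(1 + q⁻¹)) • h8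
    · linear_combination (norm := ((try simp only [pow_two]); match_scalars <;> (try field_simp) <;> (try ring))) (-q⁻¹) • h4
    · linear_combination (norm := ((try simp only [pow_two]); match_scalars <;> (try field_simp) <;> (try ring))) (-q⁻¹) • h4
    · linear_combination (norm := ((try simp only [pow_two]); match_scalars <;> (try field_simp) <;> (try ring))) (-r) • h8
end

section
/- The FRT relation R₁,₁ T₁ T₂ = T₂ T₁ R₁,₁ (an equality of 4×4 matrices over 𝔸) holds if and only if the elements a,b,c,d satisfy the A₁,₁ relations: ba − r·ab + s·dc = 0, ca − r·ac + s·db = 0, bd + r·db − s·ac = 0, cd + r·dc − s·ab = 0, ad − da = 0, bc − cb = 0, b² = c² = (s/2)(a² − d²). -/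
open Matrix Kronecker

/-- The matrix `R₁,₁`, with rows and columns indexed by the ordered basis
`e₁⊗e₁, e₁⊗e₂, e₂⊗e₁, e₂⊗e₂` of `ℂ²⊗ℂ²`, i.e. by pairs `(0,0), (0,1), (1,0), (1,1)`. -/
noncomputable def R11mat (r s : ℂ) : Matrix (Fin 2 × Fin 2) (Fin 2 × Fin 2) ℂ :=
  fun p p' => r⁻¹ *
    (if p = ((0 : Fin 2), (0 : Fin 2)) ∧ p' = (0, 0) then s + 1
     else if p = ((0 : Fin 2), (0 : Fin 2)) ∧ p' = (1, 1) then s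
     else if p = ((0 : Fin 2), (1 : Fin 2)) ∧ p' = (0, 1) then r
     else if p = ((0 : Fin 2), (1 : Fin 2)) ∧ p' = (1, 0) then s
     else if p = ((1 : Fin 2), (0 : Fin 2)) ∧ p' = (0, 1) then s
     else if p = ((1 : Fin 2), (0 : Fin 2)) ∧ p' = (1, 0) then r
     else if p = ((1 : Fin 2), (1 : Fin 2)) ∧ p' = (0, 0) then s
     else if p = ((1 : Fin 2), (1 : Fin 2)) ∧ p' = (1, 1) then s - 1
     else 0)

/-- The FRT relation `R₁,₁ T₁ T₂ = T₂ T₁ R₁,₁` holds iff `a,b,c,d` satisfy the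
`A₁,₁` relations. -/
theorem frt_R11_iff (r s : ℂ) (hr : r ≠ 0) (hs : s ≠ 0) (hrs : r ^ 2 - s ^ 2 = 1)
    {𝔸 : Type*} [Ring 𝔸] [Algebra ℂ 𝔸] (a b c d : 𝔸) :
    (let T : Matrix (Fin 2) (Fin 2) 𝔸 := !![a, b; c, d]
     let T₁ := T ⊗ₖ (1 : Matrix (Fin 2) (Fin 2) 𝔸)
     let T₂ := (1 : Matrix (Fin 2) (Fin 2) 𝔸) ⊗ₖ T
     (R11mat r s).map (algebraMap ℂ 𝔸) * (T₁ * T₂)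
       = (T₂ * T₁) * (R11mat r s).map (algebraMap ℂ 𝔸)) ↔
    (b * a - r • (a * b) + s • (d * c) = 0 ∧
     c * a - r • (a * c) + s • (d * b) = 0 ∧
     b * d + r • (d * b) - s • (a * c) = 0 ∧
     c * d + r • (d * c) - s • (a * b) = 0 ∧
     a * d - d * a = 0 ∧
     b * c - c * b = 0 ∧
     b ^ 2 = (s / 2) • (a ^ 2 - d ^ 2) ∧
     c ^ 2 = (s / 2) • (a ^ 2 - d ^ 2)) := by
  have hsc : ∀ (z : ℂ) (x : 𝔸), algebraMap ℂ 𝔸 z * x = z • x := fun z x =>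
    (Algebra.smul_def z x).symm
  have hsc' : ∀ (z : ℂ) (x : 𝔸), x * algebraMap ℂ 𝔸 z = z • x := fun z x => by
    rw [← Algebra.commutes, Algebra.smul_def]
  have hcan : ∀ x y : 𝔸, r⁻¹ • x = r⁻¹ • y ↔ x = y := fun x y =>
    (smul_right_injective 𝔸 (inv_ne_zero hr)).eq_iff
  rw [← Matrix.ext_iff]
  simp only [Prod.forall, Fin.forall_fin_two, Matrix.mul_apply, Fintype.sum_prod_type,
    Fin.sum_univ_two, Matrix.map_apply, hsc, hsc', Matrix.kroneckerMap_apply]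
  simp [R11mat]

  simp only [mul_smul, ← smul_add, hcan, pow_two]
  constructor
  · rintro ⟨⟨⟨⟨e1, e2⟩, e3, e4⟩, ⟨e5, e6⟩, e7, e8⟩, ⟨⟨e9, e10⟩, e11, e12⟩, ⟨e13, e14⟩, e15, e16⟩
    have e6' : a * d = d * a := smul_right_injective 𝔸 hr e6
    have e7' : b * c = c * b := by
      apply smul_right_injective 𝔸 hr
      change r • (b * c) = r • (c * b)
      linear_combination (norm := module) e7
    refine ⟨?_, ?_, ?_, ?_, sub_eq_zero.2 e6', sub_eq_zero.2 e7', ?_, ?_⟩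
    · linear_combination (norm := module) e3
    · linear_combination (norm := module) -e5
    · linear_combination (norm := module) e12
    · linear_combination (norm := module) -e14
    · linear_combination (norm := module) (1 / 2 : ℂ) • e4
    · linear_combination (norm := module) (-1 / 2 : ℂ) • e13
  · rintro ⟨R1, R2, R3, R4, R5, R6, R7, R8⟩
    refine ⟨⟨⟨⟨?_, ?_⟩, ?_, ?_⟩, ⟨?_, ?_⟩, ?_, ?_⟩, ⟨⟨?_, ?_⟩, ?_, ?_⟩, ⟨?_, ?_⟩, ?_, ?_⟩
    · linear_combination (norm := module) s • R8 - s • R7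
    · linear_combination (norm := module) s • R4 - r • R1 - hrs • (a * b)
    · linear_combination (norm := module) R1
    · linear_combination (norm := module) (2 : ℂ) • R7
    · linear_combination (norm := module) -R2
    · linear_combination (norm := module) r • R5
    · linear_combination (norm := module) r • R6
    · linear_combination (norm := module) r • R3 - s • R2 - hrs • (d * b)
    · linear_combination (norm := module) r • R2 - s • R3 + hrs • (a * c)
    · linear_combination (norm := module) (-r) • R6
    · linear_combination (norm := module) (-r) • R5
    · linear_combination (norm := module) R3
    · linear_combination (norm := module) (-2 : ℂ) • R8
    · linear_combination (norm := module) -R4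
    · linear_combination (norm := module) s • R1 - r • R4 + hrs • (d * c)
    · linear_combination (norm := module) s • R7 - s • R8
end

section
/- The braided FRT relation R₁,₂ (ηT₁)(ηT₂) = (ηT₂)(ηT₁) R₁,₂ (an equality of 4×4 matrices over 𝔸), where η = diag(1,1,1,−1), holds if and only if the elements a,b,c,d satisfy the braided A₁,₂ relations: ba − ab + r·q·dc = 0, ca − q·ac = 0, bd − db + r·q·ac = 0, cd − q·dc = 0, ad − da + (1−q)·bc = 0, cb + q·bc = 0, (1+q)·b² − r·q·(a²−d²) = 0, c² = 0. -/
open Matrix Kronecker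

/-- The superidentity (braiding) matrix `η = diag(1,1,1,−1)`, over an algebra `𝔸`. -/
def eta (𝔸 : Type*) [Ring 𝔸] : Matrix (Fin 2 × Fin 2) (Fin 2 × Fin 2) 𝔸 :=
  fun p p' => if p = p' then (if p = ((1 : Fin 2), (1 : Fin 2)) then -1 else 1) else 0

/-- The braided FRT relation `R₁,₂ (ηT₁)(ηT₂) = (ηT₂)(ηT₁) R₁,₂` holds iff `a,b,c,d`
satisfy the braided `A₁,₂` relations. -/
theorem braided_frt_R12_iff (r q : ℂ) (hr : r ≠ 0) (hq : q ≠ 0) (hq1 : q ≠ 1) (hqm1 : q ≠ -1)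
    {𝔸 : Type*} [Ring 𝔸] [Algebra ℂ 𝔸] (a b c d : 𝔸) :
    (let T : Matrix (Fin 2) (Fin 2) 𝔸 := !![a, b; c, d]
     let T₁ := T ⊗ₖ (1 : Matrix (Fin 2) (Fin 2) 𝔸)
     let T₂ := (1 : Matrix (Fin 2) (Fin 2) 𝔸) ⊗ₖ T
     (R12mat r q).map (algebraMap ℂ 𝔸) * ((eta 𝔸 * T₁) * (eta 𝔸 * T₂))
       = ((eta 𝔸 * T₂) * (eta 𝔸 * T₁)) * (R12mat r q).map (algebraMap ℂ 𝔸)) ↔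
    (b * a - a * b + (r * q) • (d * c) = 0 ∧
     c * a - q • (a * c) = 0 ∧
     b * d - d * b + (r * q) • (a * c) = 0 ∧
     c * d - q • (d * c) = 0 ∧
     a * d - d * a + (1 - q) • (b * c) = 0 ∧
     c * b + q • (b * c) = 0 ∧
     (1 + q) • (b ^ 2) - (r * q) • (a ^ 2 - d ^ 2) = 0 ∧
     c ^ 2 = 0) := by
  have hcm : ∀ (x : ℂ) (y : 𝔸), y * algebraMap ℂ 𝔸 x = x • y := fun x y => by
    rw [← Algebra.commutes, Algebra.smul_def]
  have hcm' : ∀ (x : ℂ) (y : 𝔸), algebraMap ℂ 𝔸 x * y = x • y := fun x y => by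
    rw [Algebra.smul_def]
  simp only [← Matrix.ext_iff, Prod.forall, Fin.forall_fin_two, Matrix.mul_apply,
    Fintype.sum_prod_type, Fin.sum_univ_two, Matrix.map_apply, Matrix.kroneckerMap_apply,
    hcm, hcm']
  simp [R12mat, eta, -map_sub, -map_inv₀, -map_neg]
  simp only [sq]
  constructor
  · rintro ⟨⟨⟨⟨e11, e12⟩, e13, e14⟩, ⟨e21, e22⟩, e23, e24⟩, ⟨⟨e31, e32⟩, e33, e34⟩,
      ⟨e41, e42⟩, e43, e44⟩
    refine ⟨?_, ?_, ?_, ?_, ?_, ?_, ?_, e11.resolve_left hr⟩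
    · linear_combination (norm := (match_scalars <;> field_simp <;> ring)) q • e13
    · linear_combination (norm := (match_scalars <;> field_simp <;> ring)) q • e31
    · linear_combination (norm := (match_scalars <;> field_simp <;> ring)) (-q) • e34
    · linear_combination (norm := (match_scalars <;> field_simp <;> ring)) q • e42
    · linear_combination (norm := (match_scalars <;> field_simp <;> ring)) (-q) • e33
    · linear_combination (norm := (match_scalars <;> field_simp <;> ring)) q • e32
    · linear_combination (norm := (match_scalars <;> field_simp <;> ring)) q • e14
  · rintro ⟨h1, h2, h3, h4, h5, h6, h7, h8⟩
    refine ⟨⟨⟨⟨Or.inr h8, ?_⟩, ?_, ?_⟩, ⟨?_, ?_⟩, ?_, ?_⟩, ⟨⟨?_, ?_⟩, ?_, ?_⟩,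
      ⟨?_, ?_⟩, ?_, Or.inr h8⟩
    · linear_combination (norm := (match_scalars <;> field_simp <;> ring)) (-1 : ℂ) • h1 - r • h4
    · linear_combination (norm := (match_scalars <;> field_simp <;> ring)) q⁻¹ • h1
    · linear_combination (norm := (match_scalars <;> field_simp <;> ring)) q⁻¹ • h7
    · linear_combination (norm := (match_scalars <;> field_simp <;> ring)) (-q⁻¹) • h2
    · linear_combination (norm := (match_scalars <;> field_simp <;> ring)) h5 + (1 - q⁻¹) • h6
    · linear_combination (norm := (match_scalars <;> field_simp <;> ring)) (-q⁻¹) • h6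
    · linear_combination (norm := (match_scalars <;> field_simp <;> ring)) (-1 : ℂ) • h3 - r • h2
    · linear_combination (norm := (match_scalars <;> field_simp <;> ring)) q⁻¹ • h2
    · linear_combination (norm := (match_scalars <;> field_simp <;> ring)) q⁻¹ • h6
    · linear_combination (norm := (match_scalars <;> field_simp <;> ring)) (-q⁻¹) • h5
    · linear_combination (norm := (match_scalars <;> field_simp <;> ring)) (-q⁻¹) • h3
    · linear_combination (norm := (match_scalars <;> field_simp <;> ring)) (q⁻¹ + 1) • h8
    · linear_combination (norm := (match_scalars <;> field_simp <;> ring)) q⁻¹ • h4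
    · linear_combination (norm := (match_scalars <;> field_simp <;> ring)) q⁻¹ • h4
end

section
/- The braided FRT relation R₁,₁ (ηT₁)(ηT₂) = (ηT₂)(ηT₁) R₁,₁ (an equality of 4×4 matrices over 𝔸), where η = diag(1,1,1,−1), holds if and only if the elements a,b,c,d satisfy the braided A₁,₁ relations: ba − r·ab + s·dc = 0, ca − r·ac + s·db = 0, bd − r·db + s·ac = 0, cd − r·dc + s·ab = 0, ad − da = 0, bc + cb = 0, b² = −c² = (s/2)(a² − d²). -/
open Matrix Kronecker

/-- The braided FRT relation `R₁,₁ (ηT₁)(ηT₂) = (ηT₂)(ηT₁) R₁,₁` holds iff `a,b,c,d`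
satisfy the braided `A₁,₁` relations. -/
theorem braided_frt_R11_iff (r s : ℂ) (hr : r ≠ 0) (hs : s ≠ 0) (hrs : r ^ 2 - s ^ 2 = 1)
    {𝔸 : Type*} [Ring 𝔸] [Algebra ℂ 𝔸] (a b c d : 𝔸) :
    (let T : Matrix (Fin 2) (Fin 2) 𝔸 := !![a, b; c, d]
     let T₁ := T ⊗ₖ (1 : Matrix (Fin 2) (Fin 2) 𝔸)
     let T₂ := (1 : Matrix (Fin 2) (Fin 2) 𝔸) ⊗ₖ T
     (R11mat r s).map (algebraMap ℂ 𝔸) * ((eta 𝔸 * T₁) * (eta 𝔸 * T₂))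
       = ((eta 𝔸 * T₂) * (eta 𝔸 * T₁)) * (R11mat r s).map (algebraMap ℂ 𝔸)) ↔
    (b * a - r • (a * b) + s • (d * c) = 0 ∧
     c * a - r • (a * c) + s • (d * b) = 0 ∧
     b * d - r • (d * b) + s • (a * c) = 0 ∧
     c * d - r • (d * c) + s • (a * b) = 0 ∧
     a * d - d * a = 0 ∧
     b * c + c * b = 0 ∧
     b ^ 2 = -(c ^ 2) ∧
     -(c ^ 2) = (s / 2) • (a ^ 2 - d ^ 2)) := by
  dsimp only
  rw [← Matrix.ext_iff]
  simp only [Prod.forall, Fin.forall_fin_two]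
  simp [Matrix.mul_apply, Fintype.sum_prod_type, R11mat, eta, Matrix.one_apply,
    Algebra.algebraMap_eq_smul_one]
  simp only [mul_smul, ← smul_neg, ← smul_add, smul_right_inj (inv_ne_zero hr), pow_two]
  constructor
  · rintro ⟨⟨⟨⟨h00, h01⟩, h02, h03⟩, ⟨h10, h11⟩, h12, h13⟩,
      ⟨⟨h20, h21⟩, h22, h23⟩, ⟨h30, h31⟩, h32, h33⟩
    have k1 : b * b = -(c * c) := by
      apply smul_right_injective 𝔸 hs
      simp only
      linear_combination (norm := module) h33
    have k2 : a * d = d * a := smul_right_injective 𝔸 hr h11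
    have k3 : c * b = -(b * c) := by
      apply smul_right_injective 𝔸 hr
      simp only
      linear_combination (norm := module) (-1 : ℂ) • h12
    refine ⟨?_, ?_, ?_, ?_, ?_, ?_, k1, ?_⟩
    · linear_combination (norm := module) h02
    · linear_combination (norm := module) (-1 : ℂ) • h10
    · linear_combination (norm := module) (-1 : ℂ) • h23
    · linear_combination (norm := module) h31
    · linear_combination (norm := module) k2
    · linear_combination (norm := module) k3
    · linear_combination (norm := module) (-1/2 : ℂ) • h30
  · rintro ⟨h1, h2, h3, h4, h5, h6, h7, h8⟩
    refine ⟨⟨⟨⟨?_, ?_⟩, ?_, ?_⟩, ⟨?_, ?_⟩, ?_, ?_⟩, ⟨⟨?_, ?_⟩, ?_, ?_⟩, ⟨?_, ?_⟩, ?_, ?_⟩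
    · linear_combination (norm := module) (-s) • h7
    · linear_combination (norm := module) (-r) • h1 - s • h4 - hrs • (a * b)
    · linear_combination (norm := module) h1
    · linear_combination (norm := module) (2 : ℂ) • h7 + (2 : ℂ) • h8
    · linear_combination (norm := module) (-1 : ℂ) • h2
    · linear_combination (norm := module) r • h5
    · linear_combination (norm := module) (-r) • h6
    · linear_combination (norm := module) (-r) • h3 - s • h2 - hrs • (d * b)
    · linear_combination (norm := module) r • h2 + s • h3 + hrs • (a * c)
    · linear_combination (norm := module) r • h6
    · linear_combination (norm := module) (-r) • h5
    · linear_combination (norm := module) (-1 : ℂ) • h3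
    · linear_combination (norm := module) (-2 : ℂ) • h8
    · linear_combination (norm := module) h4
    · linear_combination (norm := module) r • h4 + s • h1 + hrs • (d * c)
    · linear_combination (norm := module) s • h7
end

section
/- For every integer k ≥ 2, Δ(aᵏ) = aᵏ ⊗ aᵏ + ((qᵏ−1)/(q−1))·aᵏ⁻¹b ⊗ aᵏ⁻¹c − r·q²·((qᵏ−1)(qᵏ⁻¹−1)/((q²−1)(q−1)))·aᵏ⁻²dc ⊗ aᵏ⁻¹c, and for every integer l ≥ 2, Δ(dˡ) = dˡ ⊗ dˡ + ((qˡ−1)/(q−1))·dˡ⁻¹c ⊗ dˡ⁻¹b − r·q²·((qˡ−1)(qˡ⁻¹−1)/((q²−1)(q−1)))·dˡ⁻¹c ⊗ a dˡ⁻²c. -/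
open TensorProduct

/-- Lemma 1: the coproduct of powers `aᵏ` and `dˡ` in the quantum supergroup
algebra `A₁,₂`. -/
theorem coprod_pow_a_pow_d
    (r q : ℂ) (hq : q ≠ 0) (hq1 : q ≠ 1) (hqm1 : q ≠ -1)
    {𝔸 : Type*} [Ring 𝔸] [Algebra ℂ 𝔸] (a b c d : 𝔸)
    (h1 : b * a - a * b + (r * q) • (d * c) = 0)
    (h2 : c * a - q • (a * c) = 0)
    (h3 : b * d + d * b - (r * q) • (a * c) = 0)
    (h4 : c * d + q • (d * c) = 0)
    (h5 : a * d - d * a - (1 - q) • (b * c) = 0)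
    (h6 : c * b - q • (b * c) = 0)
    (h7 : (1 + q) • (b * b) - (r * q) • (a * a - d * d) = 0)
    (h8 : c * c = 0)
    (Δ : 𝔸 →ₐ[ℂ] TensorProduct ℂ 𝔸 𝔸)
    (hΔa : Δ a = a ⊗ₜ[ℂ] a + b ⊗ₜ[ℂ] c)
    (hΔb : Δ b = a ⊗ₜ[ℂ] b + b ⊗ₜ[ℂ] d)
    (hΔc : Δ c = c ⊗ₜ[ℂ] a + d ⊗ₜ[ℂ] c)
    (hΔd : Δ d = c ⊗ₜ[ℂ] b + d ⊗ₜ[ℂ] d) :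
    (∀ k : ℕ, 2 ≤ k →
      Δ (a ^ k) = (a ^ k) ⊗ₜ[ℂ] (a ^ k)
        + ((q ^ k - 1) / (q - 1)) • ((a ^ (k - 1) * b) ⊗ₜ[ℂ] (a ^ (k - 1) * c))
        - (r * q ^ 2 * ((q ^ k - 1) * (q ^ (k - 1) - 1) / ((q ^ 2 - 1) * (q - 1)))) •
            ((a ^ (k - 2) * d * c) ⊗ₜ[ℂ] (a ^ (k - 1) * c)))
    ∧ (∀ l : ℕ, 2 ≤ l →
      Δ (d ^ l) = (d ^ l) ⊗ₜ[ℂ] (d ^ l)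
        + ((q ^ l - 1) / (q - 1)) • ((d ^ (l - 1) * c) ⊗ₜ[ℂ] (d ^ (l - 1) * b))
        - (r * q ^ 2 * ((q ^ l - 1) * (q ^ (l - 1) - 1) / ((q ^ 2 - 1) * (q - 1)))) •
            ((d ^ (l - 1) * c) ⊗ₜ[ℂ] (a * d ^ (l - 2) * c))) := by
  have hq1' : q - 1 ≠ 0 := sub_ne_zero.mpr hq1
  have hq2' : q ^ 2 - 1 ≠ 0 := by
    have : q ^ 2 - 1 = (q - 1) * (q - (-1)) := by ring
    rw [this]
    exact mul_ne_zero hq1' (sub_ne_zero.mpr hqm1)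
  have e1 : b * a = a * b - (r * q) • (d * c) := by
    rw [← sub_eq_zero, ← h1]; abel
  have e2 : c * a = q • (a * c) := sub_eq_zero.mp h2
  have e3 : b * d = (r * q) • (a * c) - d * b := by
    rw [← sub_eq_zero, ← h3]; abel
  have e4 : c * d = -(q • (d * c)) := eq_neg_of_add_eq_zero_left h4
  have e5 : d * a = a * d - (1 - q) • (b * c) := by
    rw [← sub_eq_zero, ← neg_eq_zero, ← h5]; abel
  have dac : d * a * c = a * d * c := by
    rw [e5, sub_mul, smul_mul_assoc, mul_assoc b, h8]; simp
  have cdc : c * d * c = 0 := by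
    rw [e4, neg_mul, smul_mul_assoc, mul_assoc d, h8]; simp
  have dca : d * c * a = q • (a * d * c) := by
    rw [mul_assoc, e2, mul_smul_comm, ← mul_assoc, dac]
  have cdn : ∀ n : ℕ, c * d ^ n * c = 0 := by
    intro n
    induction n with
    | zero => simpa using h8
    | succ n ih =>
      rw [pow_succ', ← mul_assoc c, e4, neg_mul, smul_mul_assoc, neg_mul, smul_mul_assoc,
        mul_assoc d, mul_assoc d, ih]; simp
  have dnac : ∀ n : ℕ, d ^ n * (a * c) = a * d ^ n * c := by
    intro n
    induction n with
    | zero => simp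
    | succ n ih =>
      rw [pow_succ', mul_assoc d, ih, ← mul_assoc d, ← mul_assoc d, e5, sub_mul, sub_mul,
        smul_mul_assoc, smul_mul_assoc, mul_assoc b, mul_assoc b, cdn]
      simp [mul_assoc]
  constructor
  · intro k hk
    obtain ⟨n, rfl⟩ := Nat.exists_eq_add_of_le' hk
    clear hk
    simp only [show n + 2 - 1 = n + 1 from rfl, show n + 2 - 2 = n from rfl]
    induction n with
    | zero =>
      rw [map_pow, hΔa, pow_two]
      simp only [add_mul, mul_add, Algebra.TensorProduct.tmul_mul_tmul, e1, e2, h8, sub_tmul,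
        tmul_smul, ← smul_tmul', tmul_zero, zero_add, pow_one, pow_zero, one_mul, smul_sub,
        smul_smul, pow_two a]
      match_scalars <;> field_simp <;> ring
    | succ n ih =>
      rw [pow_succ a (n + 1 + 1), map_mul,  ih, hΔa]
      have t1 : a ^ (n + 1) * b * a = a ^ (n + 2) * b - (r * q) • (a ^ (n + 1) * d * c) := by
        rw [mul_assoc, e1, mul_sub, mul_smul_comm]; simp only [pow_succ, mul_assoc]
      have t2 : a ^ (n + 1) * c * a = q • (a ^ (n + 2) * c) := by
        rw [mul_assoc, e2, mul_smul_comm]; simp only [pow_succ, mul_assoc]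
      have t3 : a ^ n * d * c * a = q • (a ^ (n + 1) * d * c) := by
        rw [mul_assoc (a ^ n), mul_assoc (a ^ n), dca, mul_smul_comm]
        simp only [pow_succ, mul_assoc]
      have t4 : a ^ (n + 1) * c * c = 0 := by rw [mul_assoc, h8, mul_zero]
      simp only [add_mul, sub_mul, mul_add, smul_mul_assoc, Algebra.TensorProduct.tmul_mul_tmul,
        t1, t2, t3, t4, sub_tmul, tmul_smul, ← smul_tmul', tmul_zero, smul_sub, smul_smul,
        ← pow_succ, smul_zero]
      simp only [show n + 1 + 1 = n + 2 from rfl]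
      match_scalars <;> field_simp <;> ring
  · intro k hk
    obtain ⟨n, rfl⟩ := Nat.exists_eq_add_of_le' hk
    clear hk
    simp only [show n + 2 - 1 = n + 1 from rfl, show n + 2 - 2 = n from rfl]
    induction n with
    | zero =>
      rw [map_pow, hΔd, pow_two]
      simp only [add_mul, mul_add, Algebra.TensorProduct.tmul_mul_tmul, e3, e4, h8, tmul_sub,
        neg_tmul, zero_tmul,
        tmul_smul, ← smul_tmul', zero_add, pow_one, pow_zero, mul_one, smul_sub,
        smul_smul, pow_two d]
      match_scalars <;> field_simp <;> ring
    | succ n ih =>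
      rw [pow_succ d (n + 1 + 1), map_mul, ih, hΔd]
      have t1 : d ^ (n + 1) * b * d = (r * q) • (a * d ^ (n + 1) * c) - d ^ (n + 2) * b := by
        rw [mul_assoc, e3, mul_sub, mul_smul_comm, dnac]; simp only [pow_succ, mul_assoc]
      have t2 : d ^ (n + 1) * c * d = -(q • (d ^ (n + 2) * c)) := by
        rw [mul_assoc, e4, mul_neg, mul_smul_comm]; simp only [pow_succ, mul_assoc]
      have t3 : a * d ^ n * c * d = -(q • (a * d ^ (n + 1) * c)) := by
        rw [mul_assoc, e4, mul_neg, mul_smul_comm]; simp only [pow_succ, mul_assoc]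
      have t4 : d ^ (n + 1) * c * c = 0 := by rw [mul_assoc, h8, mul_zero]
      simp only [add_mul, sub_mul, mul_add, smul_mul_assoc, Algebra.TensorProduct.tmul_mul_tmul,
        t1, t2, t3, t4, tmul_sub, tmul_neg, neg_tmul, tmul_smul, ← smul_tmul', zero_tmul,
        smul_sub, smul_neg, smul_smul, ← pow_succ, smul_zero]
      simp only [show n + 1 + 1 = n + 2 from rfl]
      match_scalars <;> field_simp <;> ring
end

section
/- For all integers k, l ≥ 2: Δ(aᵏdˡ) = aᵏdˡ ⊗ aᵏdˡ + qˡ·((qᵏ−1)(qˡ−1)/(q−1)²)·( aᵏ⁻¹dˡ⁻¹bc ⊗ aᵏ⁻¹dˡ⁻¹bc − r·q·aᵏdˡ⁻¹c ⊗ aᵏ⁻¹dˡc ) + ((qˡ−1)/(q−1))·( aᵏdˡ⁻¹c ⊗ aᵏdˡ⁻¹b − r·q²·((qˡ⁻¹−1)/(q²−1))·aᵏdˡ⁻¹c ⊗ aᵏ⁺¹dˡ⁻²c ) + qˡ·((qᵏ−1)/(q−1))·( aᵏ⁻¹dˡb ⊗ aᵏ⁻¹dˡc − r·qˡ⁺²·((qᵏ⁻¹−1)/(q²−1))·aᵏ⁻²dˡ⁺¹c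 ⊗ aᵏ⁻¹dˡc ). -/
open TensorProduct

theorem aux_cdn (q : ℂ) {𝔸 : Type*} [Ring 𝔸] [Algebra ℂ 𝔸] (c d : 𝔸)
    (cd : c * d = (-q) • (d * c)) (n : ℕ) : c * d ^ n = (-q) ^ n • (d ^ n * c) := by
  induction n with
  | zero => simp
  | succ n ih =>
    rw [pow_succ d, ← mul_assoc, ih, smul_mul_assoc, mul_assoc, cd, mul_smul_comm, smul_smul,
      ← mul_assoc, pow_succ]

theorem aux_dadn
    (q : ℂ) {𝔸 : Type*} [Ring 𝔸] [Algebra ℂ 𝔸] (a b c d : 𝔸)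
    (cd : c * d = (-q) • (d * c))
    (da : d * a = a * d - (1 - q) • (b * c))
    (cc : c * c = 0) (n : ℕ) : d * (a * d ^ n * c) = a * d ^ (n + 1) * c := by
  have h : d * (a * d ^ n * c) = (d * a) * d ^ n * c := by noncomm_ring
  have h' : b * c * d ^ n * c = 0 := by
    rw [mul_assoc b, aux_cdn q c d cd, mul_smul_comm, smul_mul_assoc, mul_assoc, mul_assoc, cc]
    simp
  rw [h, da, sub_mul, sub_mul, smul_mul_assoc, smul_mul_assoc, h', smul_zero, sub_zero,
    mul_assoc a d, pow_succ']

theorem aux_dna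
    (q : ℂ) {𝔸 : Type*} [Ring 𝔸] [Algebra ℂ 𝔸] (a b c d : 𝔸)
    (cd : c * d = (-q) • (d * c))
    (da : d * a = a * d - (1 - q) • (b * c))
    (cc : c * c = 0) (n : ℕ) : d ^ n * (a * c) = a * d ^ n * c := by
  induction n with
  | zero => simp
  | succ n ih =>
    rw [pow_succ', mul_assoc, ih, aux_dadn q a b c d cd da cc, pow_succ']

theorem aux_bdn
    (r q : ℂ) (hq1 : q ≠ 1) {𝔸 : Type*} [Ring 𝔸] [Algebra ℂ 𝔸] (a b c d : 𝔸)
    (bd : b * d = (r * q) • (a * c) - d * b)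
    (cd : c * d = (-q) • (d * c))
    (da : d * a = a * d - (1 - q) • (b * c))
    (cc : c * c = 0) (n : ℕ) :
    b * d ^ (n + 1) = (-1 : ℂ) ^ (n + 1) • (d ^ (n + 1) * b
      - (r * q * ((q ^ (n + 1) - 1) / (q - 1))) • (a * d ^ n * c)) := by
  have hq1' : q - 1 ≠ 0 := sub_ne_zero.mpr hq1
  induction n with
  | zero =>
    simp [bd, div_self hq1']
  | succ n ih =>
    rw [pow_succ d (n + 1), ← mul_assoc, ih, smul_mul_assoc, sub_mul, smul_mul_assoc,
      mul_assoc _ b d, bd, mul_sub, mul_smul_comm, aux_dna q a b c d cd da cc,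
      mul_assoc _ c d, cd, mul_smul_comm]
    have e1 : a * d ^ n * (d * c) = a * d ^ (n + 1) * c := by rw [pow_succ]; noncomm_ring
    have e2 : d ^ (n + 1) * (d * b) = d ^ (n + 1) * d * b := by noncomm_ring
    rw [e1, e2]
    match_scalars <;> field_simp <;> ring

theorem aux_Da
    (r q : ℂ) (hq1 : q ≠ 1) (hq2 : q ^ 2 - 1 ≠ 0)
    {𝔸 : Type*} [Ring 𝔸] [Algebra ℂ 𝔸] (a b c d : 𝔸)
    (ba : b * a = a * b - (r * q) • (d * c))
    (ca : c * a = q • (a * c))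
    (da : d * a = a * d - (1 - q) • (b * c))
    (cc : c * c = 0) (n : ℕ) :
    (a ⊗ₜ[ℂ] a + b ⊗ₜ[ℂ] c) ^ (n + 2) = (a ^ (n + 2)) ⊗ₜ[ℂ] (a ^ (n + 2))
      + ((q ^ (n + 2) - 1) / (q - 1)) • ((a ^ (n + 1) * b) ⊗ₜ[ℂ] (a ^ (n + 1) * c)
        - (r * q ^ 2 * ((q ^ (n + 1) - 1) / (q ^ 2 - 1))) •
          ((a ^ n * d * c) ⊗ₜ[ℂ] (a ^ (n + 1) * c))) := by
  have hq1' : q - 1 ≠ 0 := sub_ne_zero.mpr hq1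
  induction n with
  | zero =>
    simp only [pow_two, add_mul, mul_add, Algebra.TensorProduct.tmul_mul_tmul, ba, ca, cc,
      zero_add, pow_zero, pow_one, one_mul, sub_tmul, tmul_smul, smul_tmul', tmul_zero]
    simp only [← smul_tmul', tmul_sub]
    rw [← pow_two q]
    match_scalars <;> field_simp <;> ring
  | succ n ih =>
    have e1 : a ^ (n + 1) * b * a = a ^ (n + 2) * b - (r * q) • (a ^ (n + 1) * d * c) := by
      rw [mul_assoc, ba, mul_sub, mul_smul_comm, pow_succ a (n + 1), mul_assoc, mul_assoc]
    have e2 : a ^ (n + 1) * c * a = q • (a ^ (n + 2) * c) := by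
      rw [mul_assoc, ca, mul_smul_comm, pow_succ a (n + 1), mul_assoc]
    have e3 : a ^ n * d * c * a = q • (a ^ (n + 1) * d * c) := by
      have : d * c * a = q • (a * d * c) := by
        rw [mul_assoc, ca, mul_smul_comm, ← mul_assoc, da, sub_mul, smul_mul_assoc, mul_assoc b, cc]
        simp
      rw [mul_assoc (a ^ n) d c, mul_assoc, this, mul_smul_comm, pow_succ a n]
      simp only [mul_assoc]
    have e4 : a ^ (n + 1) * c * c = 0 := by rw [mul_assoc, cc, mul_zero]
    rw [pow_succ _ (n + 2), ih]
    simp only [add_mul, mul_add, sub_mul, smul_mul_assoc, Algebra.TensorProduct.tmul_mul_tmul,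
      e1, e2, e3, e4, tmul_zero, sub_tmul, tmul_smul, ← smul_tmul', ← pow_succ]
    match_scalars <;> field_simp <;> ring

theorem aux_Dd
    (r q : ℂ) (hq1 : q ≠ 1) (hq2 : q ^ 2 - 1 ≠ 0)
    {𝔸 : Type*} [Ring 𝔸] [Algebra ℂ 𝔸] (a b c d : 𝔸)
    (bd : b * d = (r * q) • (a * c) - d * b)
    (cd : c * d = (-q) • (d * c))
    (da : d * a = a * d - (1 - q) • (b * c))
    (cc : c * c = 0) (n : ℕ) :
    (c ⊗ₜ[ℂ] b + d ⊗ₜ[ℂ] d) ^ (n + 2) = (d ^ (n + 2)) ⊗ₜ[ℂ] (d ^ (n + 2))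
      + ((q ^ (n + 2) - 1) / (q - 1)) • ((d ^ (n + 1) * c) ⊗ₜ[ℂ] (d ^ (n + 1) * b)
        - (r * q ^ 2 * ((q ^ (n + 1) - 1) / (q ^ 2 - 1))) •
          ((d ^ (n + 1) * c) ⊗ₜ[ℂ] (a * d ^ n * c))) := by
  have hq1' : q - 1 ≠ 0 := sub_ne_zero.mpr hq1
  induction n with
  | zero =>
    simp only [pow_two, add_mul, mul_add, Algebra.TensorProduct.tmul_mul_tmul, bd, cd, cc,
      zero_add, pow_zero, pow_one, mul_one, tmul_sub, tmul_smul, zero_tmul, ← smul_tmul']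
    rw [← pow_two q]
    match_scalars <;> field_simp <;> ring
  | succ n ih =>
    have e1 : d ^ (n + 1) * b * d = (r * q) • (a * d ^ (n + 1) * c) - d ^ (n + 2) * b := by
      rw [mul_assoc, bd, mul_sub, mul_smul_comm, aux_dna q a b c d cd da cc,
        pow_succ d (n + 1), mul_assoc _ d b]
    have e2 : d ^ (n + 1) * c * d = (-q) • (d ^ (n + 2) * c) := by
      rw [mul_assoc, cd, mul_smul_comm, pow_succ d (n + 1), mul_assoc _ d c]
    have e3 : a * d ^ n * c * d = (-q) • (a * d ^ (n + 1) * c) := by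
      rw [mul_assoc, cd, mul_smul_comm, pow_succ d n]
      simp only [mul_assoc]
    have e4 : d ^ (n + 1) * c * c = 0 := by rw [mul_assoc, cc, mul_zero]
    rw [pow_succ _ (n + 2), ih]
    simp only [add_mul, mul_add, sub_mul, smul_mul_assoc, Algebra.TensorProduct.tmul_mul_tmul,
      e1, e2, e3, e4, zero_tmul, tmul_sub, tmul_smul, ← smul_tmul', ← pow_succ]
    match_scalars <;> field_simp <;> ring

/-- The coproduct of `aᵏdˡ` in the quantum supergroup algebra `A₁,₂` (eq. (13)). -/
theorem coprod_akdl
    (r q : ℂ) (hq : q ≠ 0) (hq1 : q ≠ 1) (hqm1 : q ≠ -1)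
    {𝔸 : Type*} [Ring 𝔸] [Algebra ℂ 𝔸] (a b c d : 𝔸)
    (h1 : b * a - a * b + (r * q) • (d * c) = 0)
    (h2 : c * a - q • (a * c) = 0)
    (h3 : b * d + d * b - (r * q) • (a * c) = 0)
    (h4 : c * d + q • (d * c) = 0)
    (h5 : a * d - d * a - (1 - q) • (b * c) = 0)
    (h6 : c * b - q • (b * c) = 0)
    (h7 : (1 + q) • (b * b) - (r * q) • (a * a - d * d) = 0)
    (h8 : c * c = 0)
    (Δ : 𝔸 →ₐ[ℂ] TensorProduct ℂ 𝔸 𝔸)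
    (hΔa : Δ a = a ⊗ₜ[ℂ] a + b ⊗ₜ[ℂ] c)
    (hΔb : Δ b = a ⊗ₜ[ℂ] b + b ⊗ₜ[ℂ] d)
    (hΔc : Δ c = c ⊗ₜ[ℂ] a + d ⊗ₜ[ℂ] c)
    (hΔd : Δ d = c ⊗ₜ[ℂ] b + d ⊗ₜ[ℂ] d) :
    ∀ k l : ℕ, 2 ≤ k → 2 ≤ l →
      Δ (a ^ k * d ^ l) = (a ^ k * d ^ l) ⊗ₜ[ℂ] (a ^ k * d ^ l)
        + (q ^ l * ((q ^ k - 1) * (q ^ l - 1) / (q - 1) ^ 2)) •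
            ((a ^ (k - 1) * d ^ (l - 1) * b * c) ⊗ₜ[ℂ] (a ^ (k - 1) * d ^ (l - 1) * b * c)
              - (r * q) • ((a ^ k * d ^ (l - 1) * c) ⊗ₜ[ℂ] (a ^ (k - 1) * d ^ l * c)))
        + ((q ^ l - 1) / (q - 1)) •
            ((a ^ k * d ^ (l - 1) * c) ⊗ₜ[ℂ] (a ^ k * d ^ (l - 1) * b)
              - (r * q ^ 2 * ((q ^ (l - 1) - 1) / (q ^ 2 - 1))) •
                  ((a ^ k * d ^ (l - 1) * c) ⊗ₜ[ℂ] (a ^ (k + 1) * d ^ (l - 2) * c)))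
        + (q ^ l * ((q ^ k - 1) / (q - 1))) •
            ((a ^ (k - 1) * d ^ l * b) ⊗ₜ[ℂ] (a ^ (k - 1) * d ^ l * c)
              - (r * q ^ (l + 2) * ((q ^ (k - 1) - 1) / (q ^ 2 - 1))) •
                  ((a ^ (k - 2) * d ^ (l + 1) * c) ⊗ₜ[ℂ] (a ^ (k - 1) * d ^ l * c))) := by
  intro k l hk hl
  obtain ⟨m, rfl⟩ := Nat.exists_eq_add_of_le' hk
  obtain ⟨n, rfl⟩ := Nat.exists_eq_add_of_le' hl
  have hq1' : q - 1 ≠ 0 := sub_ne_zero.mpr hq1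
  have hq2 : q ^ 2 - 1 ≠ 0 := by
    have : q ^ 2 - 1 = (q - 1) * (q - -1) := by ring
    rw [this]
    exact mul_ne_zero hq1' (sub_ne_zero.mpr hqm1)
  have ba : b * a = a * b - (r * q) • (d * c) := by
    rw [← sub_eq_zero, ← h1]; abel
  have ca : c * a = q • (a * c) := sub_eq_zero.mp h2
  have bd : b * d = (r * q) • (a * c) - d * b := by
    rw [← sub_eq_zero, ← h3]; abel
  have cd : c * d = (-q) • (d * c) := by
    rw [← sub_eq_zero, ← h4]; module
  have da : d * a = a * d - (1 - q) • (b * c) := by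
    rw [eq_comm, ← sub_eq_zero, ← h5]; abel
  have cb : c * b = q • (b * c) := sub_eq_zero.mp h6
  have hs : ((-1 : ℂ) ^ n) ^ 2 = 1 := by rw [← pow_mul, mul_comm, pow_mul]; simp
  have cdn := aux_cdn q c d cd
  have bdn := aux_bdn r q hq1 a b c d bd cd da h8
  have nq : ∀ j : ℕ, (-q) ^ j = (-1) ^ j * q ^ j := fun j => neg_pow q j
  have cdc : ∀ j : ℕ, c * (d ^ j * c) = 0 := fun j => by
    rw [← mul_assoc, cdn, smul_mul_assoc, mul_assoc, h8]; simp
  have e1 : a ^ (m + 1) * b * d ^ (n + 2) = (-1 : ℂ) ^ n • (a ^ (m + 1) * d ^ (n + 2) * b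
      - (r * q * ((q ^ (n + 2) - 1) / (q - 1))) • (a ^ (m + 2) * d ^ (n + 1) * c)) := by
    have : a ^ (m + 1) * (a * d ^ (n + 1) * c) = a ^ (m + 2) * d ^ (n + 1) * c := by
      rw [pow_succ a (m + 1)]; simp only [mul_assoc]
    rw [mul_assoc, bdn, mul_smul_comm, mul_sub, mul_smul_comm, this, pow_add (-1 : ℂ) n (1 + 1),
      ← mul_assoc]
    norm_num
  have e2 : a ^ (m + 1) * c * d ^ (n + 2)
      = ((-1) ^ n * q ^ (n + 2)) • (a ^ (m + 1) * d ^ (n + 2) * c) := by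
    rw [mul_assoc, cdn, mul_smul_comm, nq, ← mul_assoc, pow_add (-1 : ℂ) n 2]
    norm_num
  have e3 : a ^ m * d * c * d ^ (n + 2)
      = ((-1) ^ n * q ^ (n + 2)) • (a ^ m * d ^ (n + 3) * c) := by
    rw [mul_assoc, cdn, mul_smul_comm, nq, pow_add (-1 : ℂ) n 2, pow_succ' d (n + 2)]
    simp only [mul_assoc]
    norm_num
  have e4 : a ^ (m + 1) * b * (d ^ (n + 1) * c)
      = (-(-1 : ℂ) ^ n) • (a ^ (m + 1) * d ^ (n + 1) * b * c) := by
    have : a ^ (m + 1) * b * (d ^ (n + 1) * c) = a ^ (m + 1) * (b * d ^ (n + 1)) * c := by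
      simp only [mul_assoc]
    rw [this, bdn, mul_smul_comm, smul_mul_assoc, mul_sub, sub_mul, mul_smul_comm, smul_mul_assoc,
      mul_assoc (a ^ (m + 1)) (a * d ^ n * c) c, mul_assoc (a * d ^ n) c c, h8, pow_succ (-1 : ℂ)]
    simp [mul_assoc]
  have e5 : a ^ (m + 1) * c * (d ^ (n + 1) * b)
      = (-(-1 : ℂ) ^ n * q ^ (n + 2)) • (a ^ (m + 1) * d ^ (n + 1) * b * c) := by
    have : a ^ (m + 1) * c * (d ^ (n + 1) * b) = a ^ (m + 1) * (c * d ^ (n + 1)) * b := by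
      simp only [mul_assoc]
    rw [this, cdn, mul_smul_comm, smul_mul_assoc, mul_assoc, mul_assoc, cb, mul_smul_comm,
      mul_smul_comm, smul_smul, nq]
    simp only [← mul_assoc]
    congr 1
    ring
  have e6 : a ^ (m + 1) * c * (a * d ^ n * c) = 0 := by
    have : a ^ (m + 1) * c * (a * d ^ n * c) = a ^ (m + 1) * ((c * a) * (d ^ n * c)) := by
      simp only [mul_assoc]
    rw [this, ca, smul_mul_assoc, mul_assoc, cdc]; simp
  have e7 : a ^ m * d * c * (d ^ (n + 1) * c) = 0 := by
    rw [mul_assoc, cdc, mul_zero]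
  have e8 : a ^ (m + 2) * (a * d ^ n * c) = a ^ (m + 3) * d ^ n * c := by
    rw [pow_succ a (m + 2)]; simp only [mul_assoc]
  have e9 : a ^ (m + 2) * (d ^ (n + 1) * c) = a ^ (m + 2) * d ^ (n + 1) * c := by
    rw [mul_assoc]
  have e10 : a ^ (m + 2) * (d ^ (n + 1) * b) = a ^ (m + 2) * d ^ (n + 1) * b := by
    rw [mul_assoc]
  rw [map_mul, map_pow, map_pow, hΔa, hΔd, aux_Da r q hq1 hq2 a b c d ba ca da h8,
    aux_Dd r q hq1 hq2 a b c d bd cd da h8]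
  have t1 : m + 2 - 1 = m + 1 := rfl
  have t2 : m + 2 - 2 = m := rfl
  have t3 : n + 2 - 1 = n + 1 := rfl
  have t4 : n + 2 - 2 = n := rfl
  have t5 : m + 2 + 1 = m + 3 := rfl
  have t6 : n + 2 + 1 = n + 3 := rfl
  rw [t1, t2, t3, t4, t5, t6]
  simp only [add_mul, mul_add, sub_mul, mul_sub, smul_mul_assoc, mul_smul_comm,
    Algebra.TensorProduct.tmul_mul_tmul,
    e1, e2, e3, e4, e5, e6, e7, e8, e9, e10, zero_tmul, tmul_zero, tmul_sub, sub_tmul, tmul_smul,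
    ← smul_tmul']
  generalize (-1 : ℂ) ^ n = s at hs
  match_scalars <;> field_simp <;> (try simp only [hs]) <;> ring
end

section
/- For all integers k, l ≥ 1: Δ(aᵏdˡc) = aᵏdˡc ⊗ aᵏ⁺¹dˡ + aᵏdˡ⁺¹ ⊗ aᵏdˡc − ((qˡ−1)/(q−1))·aᵏdˡc ⊗ aᵏdˡ⁻¹bc + qˡ⁺¹·((qᵏ−1)/(q−1))·aᵏ⁻¹dˡbc ⊗ aᵏdˡc. -/
open TensorProduct

/-- The coproduct of `aᵏdˡc` in the quantum supergroup algebra `A₁,₂` (eq. (14)). -/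
theorem coprod_akdlc
    (r q : ℂ) (hq : q ≠ 0) (hq1 : q ≠ 1) (hqm1 : q ≠ -1)
    {𝔸 : Type*} [Ring 𝔸] [Algebra ℂ 𝔸] (a b c d : 𝔸)
    (h1 : b * a - a * b + (r * q) • (d * c) = 0)
    (h2 : c * a - q • (a * c) = 0)
    (h3 : b * d + d * b - (r * q) • (a * c) = 0)
    (h4 : c * d + q • (d * c) = 0)
    (h5 : a * d - d * a - (1 - q) • (b * c) = 0)
    (h6 : c * b - q • (b * c) = 0)
    (h7 : (1 + q) • (b * b) - (r * q) • (a * a - d * d) = 0)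
    (h8 : c * c = 0)
    (Δ : 𝔸 →ₐ[ℂ] TensorProduct ℂ 𝔸 𝔸)
    (hΔa : Δ a = a ⊗ₜ[ℂ] a + b ⊗ₜ[ℂ] c)
    (hΔb : Δ b = a ⊗ₜ[ℂ] b + b ⊗ₜ[ℂ] d)
    (hΔc : Δ c = c ⊗ₜ[ℂ] a + d ⊗ₜ[ℂ] c)
    (hΔd : Δ d = c ⊗ₜ[ℂ] b + d ⊗ₜ[ℂ] d) :
    ∀ k l : ℕ, 1 ≤ k → 1 ≤ l →
      Δ (a ^ k * d ^ l * c) = (a ^ k * d ^ l * c) ⊗ₜ[ℂ] (a ^ (k + 1) * d ^ l)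
        + (a ^ k * d ^ (l + 1)) ⊗ₜ[ℂ] (a ^ k * d ^ l * c)
        - ((q ^ l - 1) / (q - 1)) •
            ((a ^ k * d ^ l * c) ⊗ₜ[ℂ] (a ^ k * d ^ (l - 1) * b * c))
        + (q ^ (l + 1) * ((q ^ k - 1) / (q - 1))) •
            ((a ^ (k - 1) * d ^ l * b * c) ⊗ₜ[ℂ] (a ^ k * d ^ l * c)) := by
  have e1 : b * a = a * b - (r * q) • (d * c) := by
    rw [← sub_eq_zero, ← h1]; abel
  have e2 : c * a = q • (a * c) := sub_eq_zero.mp h2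
  have e3 : b * d = (r * q) • (a * c) - d * b := by
    rw [← sub_eq_zero, ← h3]; abel
  have e4 : c * d = (-q) • (d * c) := by
    rw [neg_smul]; exact eq_neg_of_add_eq_zero_left h4
  have e5 : d * a = a * d - (1 - q) • (b * c) := by
    rw [eq_sub_iff_add_eq, ← sub_eq_zero, ← neg_eq_zero, ← h5]; abel
  have e6 : c * b = q • (b * c) := sub_eq_zero.mp h6
  have hq' : q - 1 ≠ 0 := sub_ne_zero.mpr hq1
  have ca : ∀ k : ℕ, c * a ^ k = (q ^ k) • (a ^ k * c) := by
    intro k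
    induction k with
    | zero => simp
    | succ k ih =>
      rw [pow_succ, ← mul_assoc, ih, smul_mul_assoc, mul_assoc, e2, mul_smul_comm, smul_smul,
        mul_assoc, pow_succ]
  have cd : ∀ l : ℕ, c * d ^ l = ((-q) ^ l) • (d ^ l * c) := by
    intro k
    induction k with
    | zero => simp
    | succ k ih =>
      rw [pow_succ, ← mul_assoc, ih, smul_mul_assoc, mul_assoc, e4, mul_smul_comm, smul_smul,
        mul_assoc, pow_succ]
  have cad : ∀ k l : ℕ, c * (a ^ k * d ^ l) = (q ^ k * (-q) ^ l) • (a ^ k * d ^ l * c) := by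
    intro k l
    rw [← mul_assoc, ca, smul_mul_assoc, mul_assoc, cd, mul_smul_comm, smul_smul, mul_assoc]
  have cadc : ∀ k l : ℕ, c * (a ^ k * d ^ l * c) = 0 := by
    intro k l
    rw [← mul_assoc, cad, smul_mul_assoc, mul_assoc _ c c, h8, mul_zero, smul_zero]
  have cadbc : ∀ k l : ℕ, c * (a ^ k * d ^ l * b * c) = 0 := by
    intro k l
    rw [mul_assoc _ b c, ← mul_assoc, cad, smul_mul_assoc, mul_assoc _ c, ← mul_assoc c, e6,
      smul_mul_assoc, mul_assoc b, h8, mul_zero, smul_zero, mul_zero, smul_zero]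
  have cdc : ∀ l : ℕ, c * (d ^ l * c) = 0 := by
    intro l; simpa using cadc 0 l
  have bdc : ∀ l : ℕ, b * (d ^ l * c) = ((-1 : ℂ) ^ l) • (d ^ l * b * c) := by
    intro l
    induction l with
    | zero => simp
    | succ l ih =>
      rw [pow_succ' d, mul_assoc d, ← mul_assoc b d, e3, sub_mul, smul_mul_assoc, mul_assoc a, cdc,
        mul_zero, smul_zero, zero_sub, mul_assoc d b, ih, mul_smul_comm, pow_succ (-1 : ℂ),
        mul_neg_one, neg_smul]
      simp only [mul_assoc]
  have badc : ∀ k l : ℕ,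
      b * (a ^ k * d ^ l * c) = ((-1 : ℂ) ^ l) • (a ^ k * d ^ l * b * c) := by
    intro k l
    induction k with
    | zero => simpa using bdc l
    | succ k ih =>
      have : a ^ (k + 1) * d ^ l * c = a * (a ^ k * d ^ l * c) := by
        rw [pow_succ']; simp only [mul_assoc]
      rw [this, ← mul_assoc b a, e1, sub_mul, smul_mul_assoc, mul_assoc d, cadc,
        mul_zero, smul_zero, sub_zero, mul_assoc a b, ih, mul_smul_comm, pow_succ']
      simp only [mul_assoc]
  have dad : ∀ l : ℕ, d * (a * d ^ l) = a * d ^ (l + 1) - ((1 - q) * q ^ l) • (d ^ l * b * c) := by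
    intro l
    have hh : ((-q) ^ l * (-1 : ℂ) ^ l) = q ^ l := by
      rw [← mul_pow]; ring
    rw [← mul_assoc, e5, sub_mul, smul_mul_assoc, mul_assoc b, cd, mul_smul_comm, bdc,
      smul_smul ((-q) ^ l), hh, smul_smul, pow_succ', mul_assoc]
  have base : ∀ l : ℕ, Δ (d ^ l * c) = (d ^ l * c) ⊗ₜ[ℂ] (a * d ^ l)
        + (d ^ (l + 1)) ⊗ₜ[ℂ] (d ^ l * c)
        - ((q ^ l - 1) / (q - 1)) •
            ((d ^ l * c) ⊗ₜ[ℂ] (d ^ (l - 1) * b * c)) := by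
    intro l
    induction l with
    | zero => simp [hΔc]
    | succ l ih =>
      have h0 : d ^ (l + 1) * c = d * (d ^ l * c) := by rw [pow_succ', mul_assoc]
      have h9 : ((q ^ l - 1) / (q - 1)) • (d * (d ^ (l - 1) * b * c))
          = ((q ^ l - 1) / (q - 1)) • (d ^ l * b * c) := by
        cases l with
        | zero => simp
        | succ l =>
          rw [Nat.add_sub_cancel, pow_succ' d]; simp only [mul_assoc]
      have h10 : (-q) ^ (l + 1) * (-1 : ℂ) ^ l = - q ^ (l + 1) := by
        rw [pow_succ, mul_right_comm, ← mul_pow]; ring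
      rw [h0, map_mul, ih, hΔd]
      simp only [add_mul, mul_add, mul_sub, mul_smul_comm, Algebra.TensorProduct.tmul_mul_tmul,
        cdc, TensorProduct.zero_tmul, zero_add, cd, bdc, dad]
      rw [← TensorProduct.tmul_smul _ _ (d * (d ^ (l - 1) * b * c)), h9, Nat.add_sub_cancel,
        ← h0, ← pow_succ' d (l + 1)]
      simp only [TensorProduct.tmul_sub, TensorProduct.tmul_smul, ← TensorProduct.smul_tmul',
        smul_smul, mul_comm ((-1 : ℂ) ^ l), h10]
      match_scalars <;> field_simp <;> ring
  have main : ∀ k l : ℕ,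
      Δ (a ^ k * d ^ l * c) = (a ^ k * d ^ l * c) ⊗ₜ[ℂ] (a ^ (k + 1) * d ^ l)
        + (a ^ k * d ^ (l + 1)) ⊗ₜ[ℂ] (a ^ k * d ^ l * c)
        - ((q ^ l - 1) / (q - 1)) •
            ((a ^ k * d ^ l * c) ⊗ₜ[ℂ] (a ^ k * d ^ (l - 1) * b * c))
        + (q ^ (l + 1) * ((q ^ k - 1) / (q - 1))) •
            ((a ^ (k - 1) * d ^ l * b * c) ⊗ₜ[ℂ] (a ^ k * d ^ l * c)) := by
    intro k l
    induction k with
    | zero => simpa using base l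
    | succ k ih =>
      have p : ∀ (k : ℕ) (x : 𝔸), a * (a ^ k * x) = a ^ (k + 1) * x := by
        intro k x; rw [pow_succ', mul_assoc]
      have h0 : a ^ (k + 1) * d ^ l * c = a * (a ^ k * d ^ l * c) := by
        simp only [mul_assoc, p]
      have h9 : (q ^ (l + 1) * ((q ^ k - 1) / (q - 1))) • (a * (a ^ (k - 1) * d ^ l * b * c))
          = (q ^ (l + 1) * ((q ^ k - 1) / (q - 1))) • (a ^ k * d ^ l * b * c) := by
        cases k with
        | zero => simp
        | succ k => simp only [Nat.add_sub_cancel, mul_assoc, p]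
      have h10 : q ^ (k + 1) * (-q) ^ l * (-1 : ℂ) ^ l = q ^ (k + 1 + l) := by
        rw [mul_assoc, ← mul_pow, pow_add q (k + 1)]; ring
      rw [h0, map_mul, ih, hΔa]
      simp only [add_mul, mul_add, mul_sub, mul_smul_comm, Algebra.TensorProduct.tmul_mul_tmul,
        cadc, cadbc, TensorProduct.tmul_zero, add_zero, cad, badc]
      rw [TensorProduct.smul_tmul' _ (a * (a ^ (k - 1) * d ^ l * b * c)), h9, Nat.add_sub_cancel]
      simp only [TensorProduct.tmul_smul, ← TensorProduct.smul_tmul', smul_smul, mul_assoc, p]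
      simp only [← mul_assoc, h10]
      match_scalars <;> field_simp <;> ring
  intro k l _ _
  exact main k l
end

section
/- For all integers k, l ≥ 2: Δ(aᵏdˡb) = aᵏ⁺¹dˡ ⊗ aᵏdˡb + aᵏdˡb ⊗ aᵏdˡ⁺¹ − ((qˡ−1)/(q−1))·aᵏdˡ⁻¹bc ⊗ aᵏdˡb + qˡ⁺¹·((qᵏ−1)/(q−1))·aᵏdˡb ⊗ aᵏ⁻¹dˡbc − r·qˡ⁺²·((qᵏ−1)/(q²−1))·aᵏ⁻¹(a²−d²)dˡ ⊗ aᵏ⁻¹dˡ⁺¹c + r·q²·((qˡ−1)/(q²−1))·aᵏ⁺¹dˡ⁻¹c ⊗ aᵏ(a²−d²)dˡ⁻¹ − r·q²·((qˡ−1)(qˡ⁻¹−1)/((q²−1)(q−1)))·aᵏ⁺¹dˡ⁻¹c ⊗ aᵏ⁺¹dˡ⁻²bc + r·q²ˡ⁺⁴·((qᵏ−1)(qᵏ⁻¹−1)/((q²−1)(q−1)))·aᵏ⁻²dˡ⁺¹bc ⊗ aᵏ⁻¹dˡ⁺¹c + r·q²·((qᵏ⁺ˡ⁺¹−1)/((q²−1)(q−1)))·(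 (qˡ−1)·aᵏdˡ⁻¹bc ⊗ aᵏ⁺¹dˡ⁻¹c − qˡ(qᵏ−1)·aᵏ⁻¹dˡ⁺¹c ⊗ aᵏ⁻¹dˡbc ) + r·qˡ⁺²·((qᵏ−1)(qˡ−1)/((q²−1)(q−1)))·( aᵏdˡ⁻¹bc ⊗ aᵏ⁻¹dˡ⁺¹c − q·aᵏ⁺¹dˡ⁻¹c ⊗ aᵏ⁻¹dˡbc ). -/
open TensorProduct

/-- Moving `Y` past a power of `X`, when `YX = qXY - sZ` and `ZX = q²XZ`. -/
theorem aux_comm_pow {B : Type*} [Ring B] [Algebra ℂ B] (q s : ℂ) (hq1 : q ≠ 1)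
    (X Y Z : B) (hYX : Y * X = q • (X * Y) - s • Z) (hZX : Z * X = (q ^ 2) • (X * Z)) (n : ℕ) :
    Y * X ^ (n + 1) = (q ^ (n + 1)) • (X ^ (n + 1) * Y)
      - (s * q ^ n * ((q ^ (n + 1) - 1) / (q - 1))) • (X ^ n * Z) := by
  have hq1' : q - 1 ≠ 0 := sub_ne_zero.mpr hq1
  induction n with
  | zero => simp [hYX, hq1']
  | succ n ih =>
    rw [pow_succ X (n + 1), ← mul_assoc, ih, sub_mul, smul_mul_assoc, smul_mul_assoc,
      mul_assoc _ Y X, hYX, mul_assoc _ Z X, hZX, mul_sub, mul_smul_comm, mul_smul_comm,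
      mul_smul_comm, ← mul_assoc, ← mul_assoc, ← pow_succ, ← pow_succ]
    match_scalars <;> field_simp <;> ring

/-- Moving `Z` past a power of `X`. -/
theorem aux_comm_pow' {B : Type*} [Ring B] [Algebra ℂ B] (q : ℂ)
    (X Z : B) (hZX : Z * X = (q ^ 2) • (X * Z)) (n : ℕ) :
    Z * X ^ n = (q ^ (2 * n)) • (X ^ n * Z) := by
  induction n with
  | zero => simp
  | succ n ih =>
    rw [pow_succ X n, ← mul_assoc, ih, smul_mul_assoc, mul_assoc _ Z X, hZX, mul_smul_comm,
      ← mul_assoc]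
    match_scalars
    ring

/-- The binomial-type formula for `(X + Y)^n`. -/
theorem aux_add_pow {B : Type*} [Ring B] [Algebra ℂ B] (q s : ℂ) (hq1 : q ≠ 1) (hqm1 : q ≠ -1)
    (X Y Z : B) (hYX : Y * X = q • (X * Y) - s • Z) (hZX : Z * X = (q ^ 2) • (X * Z))
    (hYY : Y * Y = 0) (hZY : Z * Y = 0) (n : ℕ) :
    (X + Y) ^ (n + 2) = X ^ (n + 2) + ((q ^ (n + 2) - 1) / (q - 1)) • (X ^ (n + 1) * Y)
      - (s * ((q ^ (n + 2) - 1) * (q ^ (n + 1) - 1) / ((q + 1) * (q - 1) ^ 2))) • (X ^ n * Z) := by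
  have hq1' : q - 1 ≠ 0 := sub_ne_zero.mpr hq1
  have hq2' : q + 1 ≠ 0 := fun h => hqm1 (eq_neg_of_add_eq_zero_left h)
  induction n with
  | zero =>
    simp only [zero_add, pow_succ, pow_zero, one_mul, mul_add, add_mul, hYX, hYY]
    match_scalars <;> field_simp <;> ring
  | succ n ih =>
    rw [pow_succ (X + Y) (n + 2), ih]
    have e1 : X ^ (n + 1) * Y * X = q • (X ^ (n + 2) * Y) - s • (X ^ (n + 1) * Z) := by
      rw [mul_assoc, hYX, mul_sub, mul_smul_comm, mul_smul_comm, ← mul_assoc, ← pow_succ]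
    have e2 : X ^ n * Z * X = (q ^ 2) • (X ^ (n + 1) * Z) := by
      rw [mul_assoc, hZX, mul_smul_comm, ← mul_assoc, ← pow_succ]
    have e3 : X ^ (n + 1) * Y * Y = 0 := by rw [mul_assoc, hYY, mul_zero]
    have e4 : X ^ n * Z * Y = 0 := by rw [mul_assoc, hZY, mul_zero]
    simp only [mul_add, add_mul, sub_mul, smul_mul_assoc, e1, e2, e3, e4, ← pow_succ]
    match_scalars <;> field_simp <;> ring

/-- The coproduct of `aᵏdˡb` in the quantum supergroup algebra `A₁,₂` (eq. (15)). -/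
theorem coprod_akdlb
    (r q : ℂ) (hq : q ≠ 0) (hq1 : q ≠ 1) (hqm1 : q ≠ -1)
    {𝔸 : Type*} [Ring 𝔸] [Algebra ℂ 𝔸] (a b c d : 𝔸)
    (h1 : b * a - a * b + (r * q) • (d * c) = 0)
    (h2 : c * a - q • (a * c) = 0)
    (h3 : b * d + d * b - (r * q) • (a * c) = 0)
    (h4 : c * d + q • (d * c) = 0)
    (h5 : a * d - d * a - (1 - q) • (b * c) = 0)
    (h6 : c * b - q • (b * c) = 0)
    (h7 : (1 + q) • (b * b) - (r * q) • (a * a - d * d) = 0)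
    (h8 : c * c = 0)
    (Δ : 𝔸 →ₐ[ℂ] TensorProduct ℂ 𝔸 𝔸)
    (hΔa : Δ a = a ⊗ₜ[ℂ] a + b ⊗ₜ[ℂ] c)
    (hΔb : Δ b = a ⊗ₜ[ℂ] b + b ⊗ₜ[ℂ] d)
    (hΔc : Δ c = c ⊗ₜ[ℂ] a + d ⊗ₜ[ℂ] c)
    (hΔd : Δ d = c ⊗ₜ[ℂ] b + d ⊗ₜ[ℂ] d) :
    ∀ k l : ℕ, 2 ≤ k → 2 ≤ l →
      Δ (a ^ k * d ^ l * b) =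
        (a ^ (k + 1) * d ^ l) ⊗ₜ[ℂ] (a ^ k * d ^ l * b)
        + (a ^ k * d ^ l * b) ⊗ₜ[ℂ] (a ^ k * d ^ (l + 1))
        - ((q ^ l - 1) / (q - 1)) •
            ((a ^ k * d ^ (l - 1) * b * c) ⊗ₜ[ℂ] (a ^ k * d ^ l * b))
        + (q ^ (l + 1) * ((q ^ k - 1) / (q - 1))) •
            ((a ^ k * d ^ l * b) ⊗ₜ[ℂ] (a ^ (k - 1) * d ^ l * b * c))
        - (r * q ^ (l + 2) * ((q ^ k - 1) / (q ^ 2 - 1))) •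
            ((a ^ (k - 1) * (a ^ 2 - d ^ 2) * d ^ l) ⊗ₜ[ℂ] (a ^ (k - 1) * d ^ (l + 1) * c))
        + (r * q ^ 2 * ((q ^ l - 1) / (q ^ 2 - 1))) •
            ((a ^ (k + 1) * d ^ (l - 1) * c) ⊗ₜ[ℂ] (a ^ k * (a ^ 2 - d ^ 2) * d ^ (l - 1)))
        - (r * q ^ 2 * ((q ^ l - 1) * (q ^ (l - 1) - 1) / ((q ^ 2 - 1) * (q - 1)))) •
            ((a ^ (k + 1) * d ^ (l - 1) * c) ⊗ₜ[ℂ] (a ^ (k + 1) * d ^ (l - 2) * b * c))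
        + (r * q ^ (2 * l + 4) * ((q ^ k - 1) * (q ^ (k - 1) - 1) / ((q ^ 2 - 1) * (q - 1)))) •
            ((a ^ (k - 2) * d ^ (l + 1) * b * c) ⊗ₜ[ℂ] (a ^ (k - 1) * d ^ (l + 1) * c))
        + (r * q ^ 2 * ((q ^ (k + l + 1) - 1) / ((q ^ 2 - 1) * (q - 1)))) •
            ((q ^ l - 1) • ((a ^ k * d ^ (l - 1) * b * c) ⊗ₜ[ℂ] (a ^ (k + 1) * d ^ (l - 1) * c))
              - (q ^ l * (q ^ k - 1)) •
                  ((a ^ (k - 1) * d ^ (l + 1) * c) ⊗ₜ[ℂ] (a ^ (k - 1) * d ^ l * b * c)))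
        + (r * q ^ (l + 2) * ((q ^ k - 1) * (q ^ l - 1) / ((q ^ 2 - 1) * (q - 1)))) •
            ((a ^ k * d ^ (l - 1) * b * c) ⊗ₜ[ℂ] (a ^ (k - 1) * d ^ (l + 1) * c)
              - q • ((a ^ (k + 1) * d ^ (l - 1) * c) ⊗ₜ[ℂ] (a ^ (k - 1) * d ^ l * b * c))) := by
  have hq1' : q - 1 ≠ 0 := sub_ne_zero.mpr hq1
  have hq2' : q + 1 ≠ 0 := fun h => hqm1 (eq_neg_of_add_eq_zero_left h)
  have hq3' : 1 + q ≠ 0 := by rwa [add_comm]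
  -- rewriting rules
  have ba : b * a = a * b - (r * q) • (d * c) := by
    rw [← sub_eq_zero, ← h1]; abel
  have ca : c * a = q • (a * c) := by rw [← sub_eq_zero, ← h2]
  have bd : b * d = (r * q) • (a * c) - d * b := by rw [← sub_eq_zero, ← h3]; abel
  have cd : c * d = (-q) • (d * c) := by rw [neg_smul]; rw [← sub_eq_zero, ← h4]; abel
  have da : d * a = a * d + (q - 1) • (b * c) := by
    have : a * d - d * a = (1 - q) • (b * c) := sub_eq_zero.mp h5
    have e : d * a = a * d - (1 - q) • (b * c) := by rw [← this]; abel
    rw [e]; module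
  have cb : c * b = q • (b * c) := by rw [← sub_eq_zero, ← h6]
  have bb : b * b = (r * q / (1 + q)) • (a * a - d * d) := by
    have e := sub_eq_zero.mp h7
    rw [div_eq_inv_mul, mul_smul, ← e, smul_smul, inv_mul_cancel₀ hq3', one_smul]
  have cc := h8
  have cax (x : 𝔸) : c * (a * x) = q • (a * (c * x)) := by
    rw [← mul_assoc, ca, smul_mul_assoc, mul_assoc]
  have cdx (x : 𝔸) : c * (d * x) = (-q) • (d * (c * x)) := by
    rw [← mul_assoc, cd, smul_mul_assoc, mul_assoc]
  have cbx (x : 𝔸) : c * (b * x) = q • (b * (c * x)) := by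
    rw [← mul_assoc, cb, smul_mul_assoc, mul_assoc]
  have ccx (x : 𝔸) : c * (c * x) = 0 := by rw [← mul_assoc, cc, zero_mul]
  have bax (x : 𝔸) : b * (a * x) = a * (b * x) - (r * q) • (d * (c * x)) := by
    rw [← mul_assoc, ba, sub_mul, smul_mul_assoc, mul_assoc, mul_assoc]
  have bdx (x : 𝔸) : b * (d * x) = (r * q) • (a * (c * x)) - d * (b * x) := by
    rw [← mul_assoc, bd, sub_mul, smul_mul_assoc, mul_assoc, mul_assoc]
  have bbx (x : 𝔸) : b * (b * x) = (r * q / (1 + q)) • (a * (a * x) - d * (d * x)) := by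
    rw [← mul_assoc, bb, smul_mul_assoc, sub_mul, mul_assoc, mul_assoc]
  have dax (x : 𝔸) : d * (a * x) = a * (d * x) + (q - 1) • (b * (c * x)) := by
    rw [← mul_assoc, da, add_mul, smul_mul_assoc, mul_assoc, mul_assoc]
  -- powers of `d` past `a`
  have E1 (n : ℕ) : d ^ (n + 1) * a
      = a * d ^ (n + 1) + (q ^ (n + 1) - 1) • (d ^ n * (b * c)) := by
    induction n with
    | zero => simp [da]
    | succ n ih =>
      have e : d ^ n * (b * c) * d = q • (d ^ (n + 1) * (b * c)) := by
        simp only [mul_assoc, cd, bdx, cc, mul_smul_comm, mul_zero, smul_zero, zero_sub, mul_neg,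
          pow_succ]
        module
      rw [pow_succ d (n + 1), mul_assoc, da, mul_add, ← mul_assoc, ih, mul_smul_comm, add_mul,
        smul_mul_assoc, e, mul_assoc a, ← pow_succ]
      match_scalars <;> ring
  have E2 (n : ℕ) : d ^ n * (a * c) = a * (d ^ n * c) := by
    cases n with
    | zero => simp
    | succ n =>
      rw [← mul_assoc, E1, add_mul, smul_mul_assoc]
      simp [mul_assoc, cc]
  have E3 (n : ℕ) : d ^ n * (a * (b * c)) = a * (d ^ n * (b * c)) := by
    cases n with
    | zero => simp
    | succ n =>
      rw [← mul_assoc, E1, add_mul, smul_mul_assoc]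
      simp [mul_assoc, cbx, cc]
  -- normal ordering behind a prefix
  have F1 (i j : ℕ) : a ^ i * d ^ (j + 1) * a = a ^ (i + 1) * d ^ (j + 1)
      + (q ^ (j + 1) - 1) • (a ^ i * d ^ j * b * c) := by
    rw [mul_assoc, E1, mul_add, mul_smul_comm, pow_succ a]
    simp only [mul_assoc]
  have F2 (i j : ℕ) : a ^ i * d ^ j * (a * c) = a ^ (i + 1) * d ^ j * c := by
    rw [mul_assoc, E2, pow_succ a]
    simp only [mul_assoc]
  have F3 (i j : ℕ) : a ^ i * d ^ j * (a * (b * c)) = a ^ (i + 1) * d ^ j * b * c := by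
    rw [mul_assoc, E3, pow_succ a]
    simp only [mul_assoc]
  have F4 (i j : ℕ) : a ^ i * d ^ j * (a * (d * c)) = a ^ (i + 1) * d ^ (j + 1) * c := by
    have e : a * (d * c) = d * (a * c) := by simp [dax, cc]
    rw [e, ← mul_assoc, mul_assoc _ _ d, ← pow_succ, F2]
  have F5 (i j : ℕ) : a ^ i * d ^ j * (a * (a * c)) = a ^ (i + 2) * d ^ j * c := by
    have e : d ^ j * (a * (a * c)) = a * (a * (d ^ j * c)) := by
      have e1 : a * (a * c) = q⁻¹ • ((a * c) * a) := by
        rw [mul_assoc, ca, mul_smul_comm, smul_smul, inv_mul_cancel₀ hq, one_smul]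
      have e2 : d ^ j * c * a = q • (d ^ j * (a * c)) := by
        rw [mul_assoc, ca, mul_smul_comm]
      rw [e1, mul_smul_comm, ← mul_assoc, E2, mul_assoc, e2, mul_smul_comm, smul_smul,
        inv_mul_cancel₀ hq, one_smul, E2]
    rw [mul_assoc, e, pow_succ a, pow_succ a]
    simp only [mul_assoc]
  have F6 (i j : ℕ) : a ^ i * d ^ (j + 1) * (a * a) = a ^ (i + 2) * d ^ (j + 1)
      + ((q ^ (j + 1) - 1) * (1 + q)) • (a ^ (i + 1) * d ^ j * b * c) := by
    have e : a ^ i * d ^ j * b * c * a = q • (a ^ (i + 1) * d ^ j * b * c) := by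
      rw [← F3]
      simp only [mul_assoc, ca, bax, cc, mul_smul_comm, mul_zero, smul_zero, sub_zero]
    rw [← mul_assoc, F1, add_mul, F1, smul_mul_assoc, e]
    match_scalars <;> ring
  have F7 (i j : ℕ) : a ^ i * d ^ (j + 1) * (a * b) = a ^ (i + 1) * d ^ (j + 1) * b
      + ((q ^ (j + 1) - 1) * q * (r * q / (1 + q))) •
        (a ^ (i + 2) * d ^ j * c - a ^ i * d ^ (j + 2) * c) := by
    have e : a ^ i * d ^ j * b * c * b = (q * (r * q / (1 + q))) •
        (a ^ (i + 2) * d ^ j * c - a ^ i * d ^ (j + 2) * c) := by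
      rw [← F5]
      simp only [mul_assoc, cb, bbx, mul_smul_comm, mul_sub, smul_smul, pow_succ, pow_zero, one_mul]
    rw [← mul_assoc, F1, add_mul, smul_mul_assoc, e]
    match_scalars <;> ring
  have G1 (i j : ℕ) : a ^ i * d ^ j * d = a ^ i * d ^ (j + 1) := by
    rw [mul_assoc, ← pow_succ]
  have G2 (i j : ℕ) (x : 𝔸) : a ^ i * d ^ j * (d * x) = a ^ i * d ^ (j + 1) * x := by
    rw [← mul_assoc, G1]
  have G3 (i j : ℕ) : a ^ i * d ^ j * (b * c) = a ^ i * d ^ j * b * c := by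
    rw [← mul_assoc]
  -- relations in the tensor square
  have YX : b ⊗ₜ[ℂ] c * a ⊗ₜ[ℂ] a = q • (a ⊗ₜ[ℂ] a * b ⊗ₜ[ℂ] c)
      - (r * q ^ 2) • ((d * c) ⊗ₜ[ℂ] (a * c)) := by
    simp only [Algebra.TensorProduct.tmul_mul_tmul, ba, ca, sub_tmul, tmul_smul, ← smul_tmul']
    module
  have ZX : (d * c) ⊗ₜ[ℂ] (a * c) * a ⊗ₜ[ℂ] a
      = (q ^ 2) • (a ⊗ₜ[ℂ] a * (d * c) ⊗ₜ[ℂ] (a * c)) := by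
    simp only [Algebra.TensorProduct.tmul_mul_tmul, mul_assoc, ca, dax, cc, mul_smul_comm,
      mul_zero, smul_zero, add_zero, tmul_smul, ← smul_tmul']
    module
  have QP : c ⊗ₜ[ℂ] b * d ⊗ₜ[ℂ] d = q • (d ⊗ₜ[ℂ] d * c ⊗ₜ[ℂ] b)
      - (r * q ^ 2) • ((d * c) ⊗ₜ[ℂ] (a * c)) := by
    simp only [Algebra.TensorProduct.tmul_mul_tmul, bd, cd, tmul_sub, tmul_smul, ← smul_tmul']
    module
  have ZP : (d * c) ⊗ₜ[ℂ] (a * c) * d ⊗ₜ[ℂ] d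
      = (q ^ 2) • (d ⊗ₜ[ℂ] d * (d * c) ⊗ₜ[ℂ] (a * c)) := by
    simp only [Algebra.TensorProduct.tmul_mul_tmul, mul_assoc, cd, dax, cc, mul_smul_comm,
      mul_zero, smul_zero, add_zero, tmul_smul, ← smul_tmul']
    module
  have YP : b ⊗ₜ[ℂ] c * d ⊗ₜ[ℂ] d = q • (d ⊗ₜ[ℂ] d * b ⊗ₜ[ℂ] c)
      - (r * q ^ 2) • ((a * c) ⊗ₜ[ℂ] (d * c)) := by
    simp only [Algebra.TensorProduct.tmul_mul_tmul, bd, cd, sub_tmul, tmul_smul, ← smul_tmul']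
    module
  have WP : (a * c) ⊗ₜ[ℂ] (d * c) * d ⊗ₜ[ℂ] d
      = (q ^ 2) • (d ⊗ₜ[ℂ] d * (a * c) ⊗ₜ[ℂ] (d * c)) := by
    simp only [Algebra.TensorProduct.tmul_mul_tmul, mul_assoc, cd, dax, cc, mul_smul_comm,
      mul_zero, smul_zero, add_zero, tmul_smul, ← smul_tmul']
    module
  have YY : b ⊗ₜ[ℂ] c * b ⊗ₜ[ℂ] c = 0 := by
    simp [Algebra.TensorProduct.tmul_mul_tmul, cc]
  have QQ : c ⊗ₜ[ℂ] b * c ⊗ₜ[ℂ] b = 0 := by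
    simp [Algebra.TensorProduct.tmul_mul_tmul, cc]
  have ZY : (d * c) ⊗ₜ[ℂ] (a * c) * b ⊗ₜ[ℂ] c = 0 := by
    simp [Algebra.TensorProduct.tmul_mul_tmul, mul_assoc, cc]
  have ZQ : (d * c) ⊗ₜ[ℂ] (a * c) * c ⊗ₜ[ℂ] b = 0 := by
    simp [Algebra.TensorProduct.tmul_mul_tmul, mul_assoc, cc]
  have WQ : (a * c) ⊗ₜ[ℂ] (d * c) * c ⊗ₜ[ℂ] b = 0 := by
    simp [Algebra.TensorProduct.tmul_mul_tmul, mul_assoc, cc]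
  have YZ : b ⊗ₜ[ℂ] c * (d * c) ⊗ₜ[ℂ] (a * c) = 0 := by
    simp [Algebra.TensorProduct.tmul_mul_tmul, cax, cc]
  have WZ : (a * c) ⊗ₜ[ℂ] (d * c) * (d * c) ⊗ₜ[ℂ] (a * c) = 0 := by
    simp [Algebra.TensorProduct.tmul_mul_tmul, mul_assoc, cax, cdx, cc]
  have ZZ : (d * c) ⊗ₜ[ℂ] (a * c) * (d * c) ⊗ₜ[ℂ] (a * c) = 0 := by
    simp [Algebra.TensorProduct.tmul_mul_tmul, mul_assoc, cax, cdx, cc]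
  have YQ : b ⊗ₜ[ℂ] c * c ⊗ₜ[ℂ] b = q • ((b * c) ⊗ₜ[ℂ] (b * c)) := by
    simp only [Algebra.TensorProduct.tmul_mul_tmul, cb, tmul_smul]
  -- products with the two summands of `Δ b`
  have QU : c ⊗ₜ[ℂ] b * (a ⊗ₜ[ℂ] b + b ⊗ₜ[ℂ] d)
      = (q * (r * q / (1 + q))) • ((a * c) ⊗ₜ[ℂ] (a * a) - (a * c) ⊗ₜ[ℂ] (d * d))
        + (q * (r * q)) • ((b * c) ⊗ₜ[ℂ] (a * c)) - q • ((b * c) ⊗ₜ[ℂ] (d * b)) := by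
    simp only [mul_add, Algebra.TensorProduct.tmul_mul_tmul, ca, cb, bb, bd, tmul_smul, tmul_sub,
      ← smul_tmul']
    module
  have ZU : (d * c) ⊗ₜ[ℂ] (a * c) * (a ⊗ₜ[ℂ] b + b ⊗ₜ[ℂ] d)
      = (q ^ 2) • ((a * (d * c)) ⊗ₜ[ℂ] (a * (b * c)) - (d * (b * c)) ⊗ₜ[ℂ] (a * (d * c))) := by
    simp only [mul_add, Algebra.TensorProduct.tmul_mul_tmul, mul_assoc, ca, cb, cd, dax, cc,
      mul_smul_comm, mul_zero, smul_zero, add_zero, tmul_smul, ← smul_tmul']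
    module
  have YU : b ⊗ₜ[ℂ] c * (a ⊗ₜ[ℂ] b + b ⊗ₜ[ℂ] d)
      = q • ((a * b) ⊗ₜ[ℂ] (b * c)) - (q * (r * q)) • ((d * c) ⊗ₜ[ℂ] (b * c))
        - (q * (r * q / (1 + q))) • ((a * a) ⊗ₜ[ℂ] (d * c) - (d * d) ⊗ₜ[ℂ] (d * c)) := by
    simp only [mul_add, Algebra.TensorProduct.tmul_mul_tmul, ba, cb, cd, bb, sub_tmul, tmul_smul,
      ← smul_tmul']
    module
  have WU : (a * c) ⊗ₜ[ℂ] (d * c) * (a ⊗ₜ[ℂ] b + b ⊗ₜ[ℂ] d)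
      = (q ^ 2) • ((a * (a * c)) ⊗ₜ[ℂ] (d * (b * c)) - (a * (b * c)) ⊗ₜ[ℂ] (d * (d * c))) := by
    simp only [mul_add, Algebra.TensorProduct.tmul_mul_tmul, mul_assoc, ca, cb, cd,
      mul_smul_comm, tmul_smul, ← smul_tmul']
    module
  have RU : (b * c) ⊗ₜ[ℂ] (b * c) * (a ⊗ₜ[ℂ] b + b ⊗ₜ[ℂ] d)
      = (q ^ 2 * (r * q / (1 + q))) •
          ((a * (b * c)) ⊗ₜ[ℂ] (a * (a * c)) - (a * (b * c)) ⊗ₜ[ℂ] (d * (d * c))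
          + (a * (a * c)) ⊗ₜ[ℂ] (d * (b * c)) - (d * (d * c)) ⊗ₜ[ℂ] (d * (b * c))) := by
    simp only [mul_add, Algebra.TensorProduct.tmul_mul_tmul, mul_assoc, ca, cb, cd, bax, bdx, bbx,
      cc, mul_smul_comm, mul_zero, smul_zero, sub_zero, zero_sub, tmul_smul, tmul_sub, sub_tmul,
      tmul_neg, ← smul_tmul']
    module
  have XP (i j : ℕ) : (a ⊗ₜ[ℂ] a) ^ i * (d ⊗ₜ[ℂ] d) ^ j
      = (a ^ i * d ^ j) ⊗ₜ[ℂ] (a ^ i * d ^ j) := by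
    rw [Algebra.TensorProduct.tmul_pow, Algebra.TensorProduct.tmul_pow,
      Algebra.TensorProduct.tmul_mul_tmul]
  intro k l hk hl
  obtain ⟨K, rfl⟩ := Nat.exists_eq_add_of_le' hk
  obtain ⟨L, rfl⟩ := Nat.exists_eq_add_of_le' hl
  have A := aux_add_pow q (r * q ^ 2) hq1 hqm1 _ _ _ YX ZX YY ZY K
  have D := aux_add_pow q (r * q ^ 2) hq1 hqm1 _ _ _ QP ZP QQ ZQ L
  have YPl := aux_comm_pow q (r * q ^ 2) hq1 _ _ _ YP WP (L + 1)
  rw [show L + 1 + 1 = L + 2 from rfl] at YPl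
  have YPl1 := aux_comm_pow q (r * q ^ 2) hq1 _ _ _ YP WP L
  have ZPl := aux_comm_pow' q _ _ ZP (L + 2)
  have ZPl1 := aux_comm_pow' q _ _ ZP (L + 1)
  have ZPl2 := aux_comm_pow' q _ _ ZP L
  rw [map_mul, map_mul, map_pow, map_pow, hΔa, hΔb, hΔd,
    add_comm (c ⊗ₜ[ℂ] b) (d ⊗ₜ[ℂ] d), A, D]
  have YPZ : b ⊗ₜ[ℂ] c * ((d ⊗ₜ[ℂ] d) ^ L * (d * c) ⊗ₜ[ℂ] (a * c)) = 0 := by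
    cases L with
    | zero => rw [pow_zero, one_mul, YZ]
    | succ M =>
      rw [← mul_assoc, aux_comm_pow q (r * q ^ 2) hq1 _ _ _ YP WP M, sub_mul, smul_mul_assoc,
        smul_mul_assoc, mul_assoc _ _ ((d * c) ⊗ₜ[ℂ] (a * c)), YZ,
        mul_assoc _ _ ((d * c) ⊗ₜ[ℂ] (a * c)), WZ]
      simp
  have YPQ : b ⊗ₜ[ℂ] c * ((d ⊗ₜ[ℂ] d) ^ (L + 1) * c ⊗ₜ[ℂ] b)
      = (q ^ (L + 2)) • ((d ⊗ₜ[ℂ] d) ^ (L + 1) * (b * c) ⊗ₜ[ℂ] (b * c)) := by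
    rw [← mul_assoc, YPl1, sub_mul, smul_mul_assoc, smul_mul_assoc,
      mul_assoc _ _ (c ⊗ₜ[ℂ] b), YQ, mul_assoc _ _ (c ⊗ₜ[ℂ] b), WQ,
      mul_zero, smul_zero, sub_zero, mul_smul_comm, smul_smul, ← pow_succ]
  have ZPQ : (d * c) ⊗ₜ[ℂ] (a * c) * ((d ⊗ₜ[ℂ] d) ^ (L + 1) * c ⊗ₜ[ℂ] b) = 0 := by
    rw [← mul_assoc, ZPl1, smul_mul_assoc, mul_assoc, ZQ, mul_zero, smul_zero]
  have ZPZ : (d * c) ⊗ₜ[ℂ] (a * c) * ((d ⊗ₜ[ℂ] d) ^ L * (d * c) ⊗ₜ[ℂ] (a * c)) = 0 := by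
    rw [← mul_assoc, ZPl2, smul_mul_assoc, mul_assoc, ZZ, mul_zero, smul_zero]
  have main : ((a ⊗ₜ[ℂ] a) ^ (K + 2)
        + ((q ^ (K + 2) - 1) / (q - 1)) • ((a ⊗ₜ[ℂ] a) ^ (K + 1) * b ⊗ₜ[ℂ] c)
        - (r * q ^ 2 * ((q ^ (K + 2) - 1) * (q ^ (K + 1) - 1) / ((q + 1) * (q - 1) ^ 2))) •
          ((a ⊗ₜ[ℂ] a) ^ K * (d * c) ⊗ₜ[ℂ] (a * c)))
      * ((d ⊗ₜ[ℂ] d) ^ (L + 2)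
        + ((q ^ (L + 2) - 1) / (q - 1)) • ((d ⊗ₜ[ℂ] d) ^ (L + 1) * c ⊗ₜ[ℂ] b)
        - (r * q ^ 2 * ((q ^ (L + 2) - 1) * (q ^ (L + 1) - 1) / ((q + 1) * (q - 1) ^ 2))) •
          ((d ⊗ₜ[ℂ] d) ^ L * (d * c) ⊗ₜ[ℂ] (a * c)))
      = (a ⊗ₜ[ℂ] a) ^ (K + 2) * (d ⊗ₜ[ℂ] d) ^ (L + 2)
        + ((q ^ (L + 2) - 1) / (q - 1)) •
          ((a ⊗ₜ[ℂ] a) ^ (K + 2) * (d ⊗ₜ[ℂ] d) ^ (L + 1) * c ⊗ₜ[ℂ] b)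
        - (r * q ^ 2 * ((q ^ (L + 2) - 1) * (q ^ (L + 1) - 1) / ((q + 1) * (q - 1) ^ 2))) •
          ((a ⊗ₜ[ℂ] a) ^ (K + 2) * (d ⊗ₜ[ℂ] d) ^ L * (d * c) ⊗ₜ[ℂ] (a * c))
        + ((q ^ (K + 2) - 1) / (q - 1) * q ^ (L + 2)) •
          ((a ⊗ₜ[ℂ] a) ^ (K + 1) * (d ⊗ₜ[ℂ] d) ^ (L + 2) * b ⊗ₜ[ℂ] c)
        - ((q ^ (K + 2) - 1) / (q - 1) *
            (r * q ^ 2 * q ^ (L + 1) * ((q ^ (L + 2) - 1) / (q - 1)))) •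
          ((a ⊗ₜ[ℂ] a) ^ (K + 1) * (d ⊗ₜ[ℂ] d) ^ (L + 1) * (a * c) ⊗ₜ[ℂ] (d * c))
        + ((q ^ (K + 2) - 1) / (q - 1) * ((q ^ (L + 2) - 1) / (q - 1)) * q ^ (L + 2)) •
          ((a ⊗ₜ[ℂ] a) ^ (K + 1) * (d ⊗ₜ[ℂ] d) ^ (L + 1) * (b * c) ⊗ₜ[ℂ] (b * c))
        - (r * q ^ 2 * ((q ^ (K + 2) - 1) * (q ^ (K + 1) - 1) / ((q + 1) * (q - 1) ^ 2))
            * q ^ (2 * (L + 2))) •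
          ((a ⊗ₜ[ℂ] a) ^ K * (d ⊗ₜ[ℂ] d) ^ (L + 2) * (d * c) ⊗ₜ[ℂ] (a * c)) := by
    simp only [mul_add, add_mul, mul_sub, sub_mul, smul_mul_assoc, mul_smul_comm]
    simp only [mul_assoc, YPZ, YPQ, ZPQ, ZPZ, YPl, ZPl, mul_zero, smul_zero, mul_sub,
      mul_smul_comm]
    module
  have s1 (i j : ℕ) : a ^ i * (a ^ 2 - d ^ 2) * d ^ j
      = a ^ (i + 2) * d ^ j - a ^ i * d ^ (j + 2) := by
    rw [mul_sub, sub_mul, ← pow_add, mul_assoc, ← pow_add, add_comm 2 j]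
  simp only [show K + 2 - 1 = K + 1 from rfl, show L + 2 - 1 = L + 1 from rfl,
    Nat.add_sub_cancel, s1, Nat.add_assoc, Nat.reduceAdd]
  rw [main]
  generalize hα : (q ^ (L + 2) - 1) * (q ^ (L + 1) - 1) / ((q + 1) * (q - 1) ^ 2) = α
  generalize hβ : (q ^ (K + 2) - 1) * (q ^ (K + 1) - 1) / ((q + 1) * (q - 1) ^ 2) = β
  conv_lhs => simp only [XP, add_mul, sub_mul, smul_mul_assoc]
  conv_lhs => simp only [mul_assoc ((a ^ _ * d ^ _) ⊗ₜ[ℂ] (a ^ _ * d ^ _)), QU, ZU, YU, WU, RU]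
  conv_lhs => simp only [mul_add, mul_sub, mul_smul_comm, Algebra.TensorProduct.tmul_mul_tmul]
  conv_lhs => simp only [F1, F2, F3, F4, F5, F6, F7, G1, G2, G3]
  subst hα hβ
  simp only [Nat.add_assoc, Nat.reduceAdd]
  simp only [tmul_add, tmul_sub, add_tmul, sub_tmul, tmul_smul, ← smul_tmul']
  have hq4' : q ^ 2 - 1 ≠ 0 := by
    have : q ^ 2 - 1 = (q - 1) * (q + 1) := by ring
    rw [this]; exact mul_ne_zero hq1' hq2'
  have hden : q ^ 2 - 1 = (q - 1) * (q + 1) := by ring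
  rw [hden, add_comm 1 q]
  match_scalars <;> field_simp <;> ring
end

section
/- For all integers k, l ≥ 1: Δ(aᵏdˡbc) = aᵏ⁺¹dˡc ⊗ aᵏ⁺¹dˡb − aᵏdˡ⁺¹b ⊗ aᵏdˡ⁺¹c + aᵏdˡbc ⊗ aᵏ⁺¹dˡ⁺¹ + aᵏ⁺¹dˡ⁺¹ ⊗ aᵏdˡbc + ((qˡ⁺¹(qᵏ⁺¹−1)−(qˡ⁺¹−1))/(q−1))·aᵏdˡbc ⊗ aᵏdˡbc + (r·q²/(q²−1))·(qˡ−1 − qˡ⁺¹(qᵏ−1))·aᵏ⁺¹dˡc ⊗ aᵏdˡ⁺¹c − r·q²·((qˡ−1)/(q²−1))·aᵏ⁺¹dˡc ⊗ aᵏ⁺²dˡ⁻¹c + r·qˡ⁺³·((qᵏ−1)/(q²−1))·aᵏ⁻¹dˡ⁺²c ⊗ aᵏdˡ⁺¹c. -/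
open TensorProduct

section helpers
variable {r q : ℂ} {𝔸 : Type*} [Ring 𝔸] [Algebra ℂ 𝔸] {a b c d : 𝔸}

theorem aux_c_apow (h2 : c * a = q • (a * c)) (i : ℕ) : c * a ^ i = q ^ i • (a ^ i * c) := by
  induction i with
  | zero => simp
  | succ n ih =>
    rw [pow_succ, ← mul_assoc, ih, smul_mul_assoc, mul_assoc, h2, mul_smul_comm, smul_smul,
      ← mul_assoc, pow_succ]

/-- `c aⁱ dʲ = qⁱ (-q)ʲ aⁱ dʲ c` -/
theorem aux_c (h2 : c * a = q • (a * c)) (h4 : c * d = (-q) • (d * c)) (i j : ℕ) :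
    c * (a ^ i * d ^ j) = (q ^ i * ((-1) ^ j * q ^ j)) • (a ^ i * d ^ j * c) := by
  rw [← mul_assoc, aux_c_apow h2, smul_mul_assoc, mul_assoc, aux_c_apow h4, mul_smul_comm,
    smul_smul, ← mul_assoc, neg_pow]

theorem aux_cc (h2 : c * a = q • (a * c)) (h4 : c * d = (-q) • (d * c)) (h8 : c * c = 0)
    (i j : ℕ) : c * (a ^ i * d ^ j * c) = 0 := by
  rw [← mul_assoc, aux_c h2 h4, smul_mul_assoc, mul_assoc, h8, mul_zero, smul_zero]

theorem aux_cb (h2 : c * a = q • (a * c)) (h4 : c * d = (-q) • (d * c))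
    (h6 : c * b = q • (b * c)) (i j : ℕ) :
    c * (a ^ i * d ^ j * b) = (q ^ i * ((-1) ^ j * q ^ j) * q) • (a ^ i * d ^ j * b * c) := by
  rw [← mul_assoc, aux_c h2 h4, smul_mul_assoc, mul_assoc _ c b, h6, mul_smul_comm, smul_smul,
    ← mul_assoc _ b c]

theorem aux_cbc (h2 : c * a = q • (a * c)) (h4 : c * d = (-q) • (d * c))
    (h6 : c * b = q • (b * c)) (h8 : c * c = 0) (i j : ℕ) :
    c * (a ^ i * d ^ j * b * c) = 0 := by
  rw [← mul_assoc, aux_cb h2 h4 h6, smul_mul_assoc, mul_assoc _ c c, h8, mul_zero, smul_zero]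

/-- `b` moves through `aⁱ dʲ` up to sign in front of anything `x` such that `c aⁱ dʲ x = 0`. -/
theorem aux_b (h1 : b * a = a * b - (r * q) • (d * c)) (h3 : b * d = (r * q) • (a * c) - d * b)
    (x : 𝔸) (hx : ∀ i j : ℕ, c * (a ^ i * d ^ j * x) = 0) (i j : ℕ) :
    b * (a ^ i * d ^ j * x) = ((-1 : ℂ) ^ j) • (a ^ i * d ^ j * (b * x)) := by
  induction i with
  | zero =>
    induction j with
    | zero => simp
    | succ n ih =>
      have e := hx 0 n
      simp only [pow_zero, one_mul] at ih e ⊢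
      rw [pow_succ', mul_assoc, ← mul_assoc b, h3, sub_mul, smul_mul_assoc, mul_assoc a, e,
        mul_assoc d b, ih, mul_smul_comm, pow_succ']
      simp [mul_assoc]
  | succ n ih =>
    have e := hx n j
    rw [pow_succ', mul_assoc a, mul_assoc a, ← mul_assoc b, h1, sub_mul, smul_mul_assoc,
      mul_assoc d, e, mul_assoc a b, ih, mul_smul_comm]
    simp [mul_assoc]

theorem aux_bc (h1 : b * a = a * b - (r * q) • (d * c)) (h3 : b * d = (r * q) • (a * c) - d * b)
    (h2 : c * a = q • (a * c)) (h4 : c * d = (-q) • (d * c)) (h8 : c * c = 0) (i j : ℕ) :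
    b * (a ^ i * d ^ j * c) = ((-1 : ℂ) ^ j) • (a ^ i * d ^ j * b * c) := by
  rw [aux_b h1 h3 c (aux_cc h2 h4 h8), ← mul_assoc]

/-- `d a x = a d x` when `c x = 0`. -/
theorem aux_da (h5 : d * a = a * d - (1 - q) • (b * c)) (x : 𝔸) (hx : c * x = 0) :
    d * (a * x) = a * (d * x) := by
  rw [← mul_assoc, h5, sub_mul, smul_mul_assoc, mul_assoc b, hx, mul_zero, smul_zero, sub_zero,
    mul_assoc]

theorem aux_dja (h5 : d * a = a * d - (1 - q) • (b * c)) (h4 : c * d = (-q) • (d * c))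
    (x : 𝔸) (hx : c * x = 0) (j : ℕ) :
    d ^ j * (a * x) = a * (d ^ j * x) := by
  induction j with
  | zero => simp
  | succ n ih =>
    rw [pow_succ', mul_assoc, ih, aux_da h5, mul_assoc]
    rw [← mul_assoc, aux_c_apow h4, smul_mul_assoc, mul_assoc, hx, mul_zero, smul_zero]

theorem aux_bbc (h1 : b * a = a * b - (r * q) • (d * c)) (h3 : b * d = (r * q) • (a * c) - d * b)
    (h2 : c * a = q • (a * c)) (h4 : c * d = (-q) • (d * c)) (h8 : c * c = 0)
    (h5 : d * a = a * d - (1 - q) • (b * c)) (h6 : c * b = q • (b * c))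
    (h7 : b * b = (r * q / (1 + q)) • (a * a - d * d)) (i j : ℕ) :
    b * (a ^ i * d ^ j * b * c) = ((-1 : ℂ) ^ j * (r * q / (1 + q))) •
      (a ^ (i + 2) * d ^ j * c - a ^ i * d ^ (j + 2) * c) := by
  have e1 : c * c = 0 := h8
  have e2 : c * (a * c) = 0 := by simpa using aux_cc h2 h4 h8 1 0
  rw [mul_assoc, aux_b h1 h3 (b * c)]
  · rw [← mul_assoc b, h7, smul_mul_assoc, mul_smul_comm, smul_smul, sub_mul, mul_sub,
      mul_assoc (a ^ i) (d ^ j) (a * a * c), mul_assoc a a c, aux_dja h5 h4 _ e2,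
      aux_dja h5 h4 _ e1]
    simp only [pow_succ, mul_assoc]
  · intro i j
    rw [← mul_assoc _ b c]
    exact aux_cbc h2 h4 h6 h8 i j

end helpers

/-- The coproduct of `aᵏdˡbc` in the quantum supergroup algebra `A₁,₂` (eq. (16)). -/
theorem coprod_akdlbc
    (r q : ℂ) (hq : q ≠ 0) (hq1 : q ≠ 1) (hqm1 : q ≠ -1)
    {𝔸 : Type*} [Ring 𝔸] [Algebra ℂ 𝔸] (a b c d : 𝔸)
    (h1 : b * a - a * b + (r * q) • (d * c) = 0)
    (h2 : c * a - q • (a * c) = 0)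
    (h3 : b * d + d * b - (r * q) • (a * c) = 0)
    (h4 : c * d + q • (d * c) = 0)
    (h5 : a * d - d * a - (1 - q) • (b * c) = 0)
    (h6 : c * b - q • (b * c) = 0)
    (h7 : (1 + q) • (b * b) - (r * q) • (a * a - d * d) = 0)
    (h8 : c * c = 0)
    (Δ : 𝔸 →ₐ[ℂ] TensorProduct ℂ 𝔸 𝔸)
    (hΔa : Δ a = a ⊗ₜ[ℂ] a + b ⊗ₜ[ℂ] c)
    (hΔb : Δ b = a ⊗ₜ[ℂ] b + b ⊗ₜ[ℂ] d)
    (hΔc : Δ c = c ⊗ₜ[ℂ] a + d ⊗ₜ[ℂ] c)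
    (hΔd : Δ d = c ⊗ₜ[ℂ] b + d ⊗ₜ[ℂ] d) :
    ∀ k l : ℕ, 1 ≤ k → 1 ≤ l →
      Δ (a ^ k * d ^ l * b * c) =
        (a ^ (k + 1) * d ^ l * c) ⊗ₜ[ℂ] (a ^ (k + 1) * d ^ l * b)
        - (a ^ k * d ^ (l + 1) * b) ⊗ₜ[ℂ] (a ^ k * d ^ (l + 1) * c)
        + (a ^ k * d ^ l * b * c) ⊗ₜ[ℂ] (a ^ (k + 1) * d ^ (l + 1))
        + (a ^ (k + 1) * d ^ (l + 1)) ⊗ₜ[ℂ] (a ^ k * d ^ l * b * c)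
        + ((q ^ (l + 1) * (q ^ (k + 1) - 1) - (q ^ (l + 1) - 1)) / (q - 1)) •
            ((a ^ k * d ^ l * b * c) ⊗ₜ[ℂ] (a ^ k * d ^ l * b * c))
        + (r * q ^ 2 / (q ^ 2 - 1) * (q ^ l - 1 - q ^ (l + 1) * (q ^ k - 1))) •
            ((a ^ (k + 1) * d ^ l * c) ⊗ₜ[ℂ] (a ^ k * d ^ (l + 1) * c))
        - (r * q ^ 2 * ((q ^ l - 1) / (q ^ 2 - 1))) •
            ((a ^ (k + 1) * d ^ l * c) ⊗ₜ[ℂ] (a ^ (k + 2) * d ^ (l - 1) * c))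
        + (r * q ^ (l + 3) * ((q ^ k - 1) / (q ^ 2 - 1))) •
            ((a ^ (k - 1) * d ^ (l + 2) * c) ⊗ₜ[ℂ] (a ^ k * d ^ (l + 1) * c)) := by
  have h1' : b * a = a * b - (r * q) • (d * c) := by
    rw [← sub_eq_zero, ← h1]; abel
  have h2' : c * a = q • (a * c) := sub_eq_zero.mp h2
  have h3' : b * d = (r * q) • (a * c) - d * b := by
    rw [← sub_eq_zero, ← h3]; abel
  have h4' : c * d = (-q) • (d * c) := by
    rw [← sub_eq_zero, ← h4, neg_smul]; abel
  have h5' : d * a = a * d - (1 - q) • (b * c) := by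
    rw [eq_comm, ← sub_eq_zero, ← h5]; abel
  have h6' : c * b = q • (b * c) := sub_eq_zero.mp h6
  have hqp : (1 + q) ≠ 0 := fun h => hqm1 (by linear_combination h)
  have hqm : (q - 1) ≠ 0 := sub_ne_zero.mpr hq1
  have hq2e : q ^ 2 - 1 = (q - 1) * (1 + q) := by ring
  have h7' : b * b = (r * q / (1 + q)) • (a * a - d * d) := by
    have h := sub_eq_zero.mp h7
    have h' := congrArg (fun x => (1 + q)⁻¹ • x) h
    simp only [smul_smul, inv_mul_cancel₀ hqp, one_smul] at h'
    rw [h']; congr 1; field_simp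
  have Lc := aux_c h2' h4'
  have Lcc := aux_cc h2' h4' h8
  have Lcb := aux_cb h2' h4' h6'
  have Lcbc := aux_cbc h2' h4' h6' h8
  have Lbc := aux_bc h1' h3' h2' h4' h8
  have Lbbc := aux_bbc h1' h3' h2' h4' h8 h5' h6' h7'
  have La : ∀ i j : ℕ, a * (a ^ i * d ^ j) = a ^ (i + 1) * d ^ j := by
    intro i j; rw [← mul_assoc, ← pow_succ']
  have Lac : ∀ i j : ℕ, a * (a ^ i * d ^ j * c) = a ^ (i + 1) * d ^ j * c := by
    intro i j; rw [← mul_assoc, La]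
  have Lab : ∀ i j : ℕ, a * (a ^ i * d ^ j * b) = a ^ (i + 1) * d ^ j * b := by
    intro i j; rw [← mul_assoc, La]
  have Labc : ∀ i j : ℕ, a * (a ^ i * d ^ j * b * c) = a ^ (i + 1) * d ^ j * b * c := by
    intro i j; rw [← mul_assoc, Lab]
  -- left multiplication by `d`
  have Ldc : ∀ i j : ℕ, d * (a ^ i * d ^ j * c) = a ^ i * d ^ (j + 1) * c := by
    intro i j
    induction i with
    | zero => simp [pow_succ', mul_assoc]
    | succ n ih =>
      rw [← Lac n (j + 1), ← ih, ← Lac n j, aux_da h5' _ (Lcc n j)]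
  have Ld0 : ∀ j : ℕ, d * (a ^ 0 * d ^ j) = a ^ 0 * d ^ (j + 1) := by
    intro j; simp [pow_succ']
  have Ld0b : ∀ j : ℕ, d * (a ^ 0 * d ^ j * b) = a ^ 0 * d ^ (j + 1) * b := by
    intro j; rw [← mul_assoc, Ld0]
  have Ld0bc : ∀ j : ℕ, d * (a ^ 0 * d ^ j * b * c) = a ^ 0 * d ^ (j + 1) * b * c := by
    intro j; rw [← mul_assoc, Ld0b]
  have Ld1 : ∀ j : ℕ, d * (a ^ (0 + 1) * d ^ j) = a ^ (0 + 1) * d ^ (j + 1)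
      - ((1 - q) * q ^ j) • (a ^ 0 * d ^ j * b * c) := by
    intro j
    rw [← La 0 j, ← mul_assoc, h5', sub_mul, smul_mul_assoc, mul_assoc a, Ld0, La, mul_assoc b,
      Lc, mul_smul_comm, Lbc, smul_smul, smul_smul]
    rcases neg_one_pow_eq_or ℂ j with h | h <;> rw [h] <;> congr 2 <;> ring
  have Ld1b : ∀ j : ℕ, d * (a ^ (0 + 1) * d ^ j * b) = a ^ (0 + 1) * d ^ (j + 1) * b
      - ((1 - q) * q ^ (j + 1) * (r * q / (1 + q))) •
        (a ^ (0 + 2) * d ^ j * c - a ^ 0 * d ^ (j + 2) * c) := by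
    intro j
    rw [← Lab 0 j, ← mul_assoc, h5', sub_mul, smul_mul_assoc, mul_assoc a, Ld0b, Lab, mul_assoc b,
      Lcb, mul_smul_comm, Lbbc, smul_smul, smul_smul]
    rcases neg_one_pow_eq_or ℂ j with h | h <;> rw [h] <;> congr 2 <;> ring
  have key : ∀ k l : ℕ,
      Δ (a ^ k * d ^ l * b * c) =
        (a ^ (k + 1) * d ^ l * c) ⊗ₜ[ℂ] (a ^ (k + 1) * d ^ l * b)
        - (a ^ k * d ^ (l + 1) * b) ⊗ₜ[ℂ] (a ^ k * d ^ (l + 1) * c)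
        + (a ^ k * d ^ l * b * c) ⊗ₜ[ℂ] (a ^ (k + 1) * d ^ (l + 1))
        + (a ^ (k + 1) * d ^ (l + 1)) ⊗ₜ[ℂ] (a ^ k * d ^ l * b * c)
        + ((q ^ (l + 1) * (q ^ (k + 1) - 1) - (q ^ (l + 1) - 1)) / (q - 1)) •
            ((a ^ k * d ^ l * b * c) ⊗ₜ[ℂ] (a ^ k * d ^ l * b * c))
        + (r * q ^ 2 / (q ^ 2 - 1) * (q ^ l - 1 - q ^ (l + 1) * (q ^ k - 1))) •
            ((a ^ (k + 1) * d ^ l * c) ⊗ₜ[ℂ] (a ^ k * d ^ (l + 1) * c))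
        - (r * q ^ 2 * ((q ^ l - 1) / (q ^ 2 - 1))) •
            ((a ^ (k + 1) * d ^ l * c) ⊗ₜ[ℂ] (a ^ (k + 2) * d ^ (l - 1) * c))
        + (r * q ^ (l + 3) * ((q ^ k - 1) / (q ^ 2 - 1))) •
            ((a ^ (k - 1) * d ^ (l + 2) * c) ⊗ₜ[ℂ] (a ^ k * d ^ (l + 1) * c)) := by
    intro k l
    induction k with
    | zero =>
      induction l with
      | zero =>
        have e : Δ (a ^ 0 * d ^ 0 * b * c) = Δ b * Δ c := by simp
        rw [e, hΔb, hΔc]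
        have e7 : q ^ 0 - 1 = 0 := by simp
        simp only [e7, zero_div, mul_zero, zero_smul, add_zero, sub_zero, zero_add, pow_one,
          pow_zero, one_mul, mul_one, add_mul, mul_add, Algebra.TensorProduct.tmul_mul_tmul]
        rw [h1', h3', h5']
        simp only [TensorProduct.tmul_sub, TensorProduct.sub_tmul, TensorProduct.tmul_smul,
          ← TensorProduct.smul_tmul']
        match_scalars <;> field_simp <;> ring
      | succ l ih =>
        have e : Δ (a ^ 0 * d ^ (l + 1) * b * c) = Δ d * Δ (a ^ 0 * d ^ l * b * c) := by
          rw [← map_mul, Ld0bc]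
        have e8 : q ^ 0 - 1 = 0 := by simp
        rw [e, hΔd, ih]
        rcases Nat.eq_zero_or_pos l with h0 | hl
        · subst h0
          simp only [e8, mul_zero, zero_div, zero_smul, add_zero, sub_zero]
          simp only [add_mul, mul_add, mul_sub, mul_smul_comm,
            Algebra.TensorProduct.tmul_mul_tmul, Lcc, Lcbc, TensorProduct.zero_tmul,
            TensorProduct.tmul_zero, smul_zero, Ldc, Ld0b, Ld0bc, Ld1, Ld1b, Lbc, Lc, Lcb, Lbbc,
            Nat.add_sub_cancel]
          simp only [TensorProduct.tmul_sub, TensorProduct.sub_tmul, TensorProduct.tmul_smul,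
            ← TensorProduct.smul_tmul', smul_sub, smul_smul]
          rw [hq2e]
          match_scalars <;> field_simp <;> ring
        · simp only [e8, mul_zero, zero_div, zero_smul, add_zero, sub_zero]
          simp only [add_mul, mul_add, mul_sub, mul_smul_comm,
            Algebra.TensorProduct.tmul_mul_tmul, Lcc, Lcbc, TensorProduct.zero_tmul,
            TensorProduct.tmul_zero, smul_zero, Ldc, Ld0b, Ld0bc, Ld1, Ld1b, Lbc, Lc, Lcb, Lbbc,
            Nat.add_sub_cancel]
          simp only [TensorProduct.tmul_sub, TensorProduct.sub_tmul, TensorProduct.tmul_smul,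
            ← TensorProduct.smul_tmul', smul_sub, smul_smul]
          have el : l - 1 + 1 = l := Nat.sub_add_cancel hl
          rw [hq2e, el]
          rcases neg_one_pow_eq_or ℂ l with h | h <;> simp only [pow_succ (-1 : ℂ) l, h] <;>
            match_scalars <;> field_simp <;> ring
    | succ k ih =>
      have e : Δ (a ^ (k + 1) * d ^ l * b * c) = Δ a * Δ (a ^ k * d ^ l * b * c) := by
        rw [← map_mul, Labc]
      rw [e, hΔa, ih]
      rcases Nat.eq_zero_or_pos k with h0 | hk
      · subst h0
        simp only [add_mul, mul_add, mul_sub, mul_smul_comm,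
          Algebra.TensorProduct.tmul_mul_tmul, Lcc, Lcbc, TensorProduct.zero_tmul,
          TensorProduct.tmul_zero, smul_zero, La, Lac, Lab, Labc, Lbc, Lc, Lcb, Lbbc,
          Nat.add_sub_cancel]
        simp only [TensorProduct.tmul_sub, TensorProduct.sub_tmul, TensorProduct.tmul_smul,
          ← TensorProduct.smul_tmul', smul_sub, smul_smul]
        rw [hq2e]
        rcases neg_one_pow_eq_or ℂ l with h | h <;> simp only [pow_succ (-1 : ℂ) l, h] <;>
          match_scalars <;> field_simp <;> ring
      · simp only [add_mul, mul_add, mul_sub, mul_smul_comm,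
          Algebra.TensorProduct.tmul_mul_tmul, Lcc, Lcbc, TensorProduct.zero_tmul,
          TensorProduct.tmul_zero, smul_zero, La, Lac, Lab, Labc, Lbc, Lc, Lcb, Lbbc,
          Nat.add_sub_cancel]
        simp only [TensorProduct.tmul_sub, TensorProduct.sub_tmul, TensorProduct.tmul_smul,
          ← TensorProduct.smul_tmul', smul_sub, smul_smul]
        have el : k - 1 + 1 = k := Nat.sub_add_cancel hk
        rw [hq2e, el]
        rcases neg_one_pow_eq_or ℂ l with h | h <;> simp only [pow_succ (-1 : ℂ) l, h] <;>
          match_scalars <;> field_simp <;> ring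
  intro k l _ _
  exact key k l
end

section
/- For all integers k, l, k', l' ≥ 1 the following reordering formulae hold in 𝔸: (i) aᵏdˡ·aᵏ'dˡ' = aᵏ⁺ᵏ'dˡ⁺ˡ' + qˡ'·((qᵏ'−1)(qˡ−1)/(q−1))·aᵏ⁺ᵏ'⁻¹dˡ⁺ˡ'⁻¹bc; (ii) aᵏdˡ·aᵏ'dˡ'b = aᵏ⁺ᵏ'dˡ⁺ˡ'b + (r·q²/(q²−1))·qˡ'(qᵏ'−1)(qˡ−1)·aᵏ⁺ᵏ'⁻¹(a²−d²)dˡ⁺ˡ'⁻¹c; (iii) aᵏdˡ·aᵏ'dˡ'c = aᵏ⁺ᵏ'dˡ⁺ˡ'c; (iv) aᵏdˡ·aᵏ'dˡ'bc = aᵏ⁺ᵏ'dˡ⁺ˡ'bc. -/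
/-- Reordering formulae (Lemma 2, part 1) in the quantum supergroup algebra `A₁,₂`. -/
theorem reorder_A12_part1
    (r q : ℂ) (hq : q ≠ 0) (hq1 : q ≠ 1) (hqm1 : q ≠ -1)
    {𝔸 : Type*} [Ring 𝔸] [Algebra ℂ 𝔸] (a b c d : 𝔸)
    (h1 : b * a - a * b + (r * q) • (d * c) = 0)
    (h2 : c * a - q • (a * c) = 0)
    (h3 : b * d + d * b - (r * q) • (a * c) = 0)
    (h4 : c * d + q • (d * c) = 0)
    (h5 : a * d - d * a - (1 - q) • (b * c) = 0)
    (h6 : c * b - q • (b * c) = 0)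
    (h7 : (1 + q) • (b * b) - (r * q) • (a * a - d * d) = 0)
    (h8 : c * c = 0) :
    ∀ k l k' l' : ℕ, 1 ≤ k → 1 ≤ l → 1 ≤ k' → 1 ≤ l' →
      (a ^ k * d ^ l * (a ^ k' * d ^ l') =
        a ^ (k + k') * d ^ (l + l')
        + (q ^ l' * ((q ^ k' - 1) * (q ^ l - 1) / (q - 1))) •
            (a ^ (k + k' - 1) * d ^ (l + l' - 1) * b * c))
      ∧ (a ^ k * d ^ l * (a ^ k' * d ^ l' * b) =
        a ^ (k + k') * d ^ (l + l') * b
        + (r * q ^ 2 / (q ^ 2 - 1) * q ^ l' * (q ^ k' - 1) * (q ^ l - 1)) •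
            (a ^ (k + k' - 1) * (a ^ 2 - d ^ 2) * d ^ (l + l' - 1) * c))
      ∧ (a ^ k * d ^ l * (a ^ k' * d ^ l' * c) = a ^ (k + k') * d ^ (l + l') * c)
      ∧ (a ^ k * d ^ l * (a ^ k' * d ^ l' * b * c) =
          a ^ (k + k') * d ^ (l + l') * b * c) := by
  have e1 : b * a = a * b - (r * q) • (d * c) := by
    rw [← sub_eq_zero, ← h1]; abel
  have e2 : c * a = q • (a * c) := sub_eq_zero.mp h2
  have e3 : b * d = (r * q) • (a * c) - d * b := by
    rw [← sub_eq_zero, ← h3]; abel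
  have e4 : c * d = -(q • (d * c)) := eq_neg_of_add_eq_zero_left h4
  have e6 : c * b = q • (b * c) := sub_eq_zero.mp h6
  have hq1' : q - 1 ≠ 0 := sub_ne_zero.mpr hq1
  have hqm' : 1 + q ≠ 0 := fun h => hqm1 (by linear_combination h)
  have hbb : b * b = (r * q / (1 + q)) • (a * a - d * d) := by
    have h := sub_eq_zero.mp h7
    rw [div_eq_inv_mul, mul_smul, ← h, smul_smul, inv_mul_cancel₀ hqm', one_smul]
  obtain ⟨x, hx⟩ : ∃ x, x = b * c := ⟨_, rfl⟩
  have hda : d * a = a * d + (q - 1) • x := by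
    have h := sub_eq_zero.mp h5
    rw [hx, sub_smul, one_smul]
    rw [sub_smul, one_smul] at h
    rw [eq_add_of_sub_eq h]; abel
  have hxc : x * c = 0 := by rw [hx, mul_assoc, h8, mul_zero]
  have hxa : x * a = q • (a * x) := by
    rw [hx, mul_assoc, e2, mul_smul_comm, ← mul_assoc, e1, sub_mul, smul_mul_assoc,
      mul_assoc d, h8, mul_zero, smul_zero, sub_zero, mul_assoc]
  have hxd : x * d = q • (d * x) := by
    rw [hx, mul_assoc, e4, mul_neg, mul_smul_comm, ← mul_assoc, e3, sub_mul, smul_mul_assoc,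
      mul_assoc a, h8, mul_zero, smul_zero, zero_sub, mul_assoc, smul_neg, neg_neg]
  have hxb : x * b = (r * q ^ 2 / (1 + q)) • ((a * a - d * d) * c) := by
    rw [hx, mul_assoc, e6, mul_smul_comm, ← mul_assoc, hbb, smul_mul_assoc, smul_smul]
    congr 1; ring
  have hxx : x * x = 0 := by
    have : x * x = x * b * c := by rw [hx]; simp only [mul_assoc]
    rw [this, hxb, smul_mul_assoc, mul_assoc, h8, mul_zero, smul_zero]
  have hxdn : ∀ n : ℕ, x * d ^ n = q ^ n • (d ^ n * x) := by
    intro n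
    induction n with
    | zero => simp
    | succ n ih =>
      rw [pow_succ, ← mul_assoc, ih, smul_mul_assoc, mul_assoc, hxd, mul_smul_comm, smul_smul,
        ← mul_assoc, pow_succ]
  have hdna : ∀ n : ℕ, d ^ (n + 1) * a = a * d ^ (n + 1) + (q ^ (n + 1) - 1) • (d ^ n * x) := by
    intro n
    induction n with
    | zero => simp [hda]
    | succ n ih =>
      rw [pow_succ' d (n + 1), mul_assoc, ih, mul_add, ← mul_assoc, hda, add_mul, smul_mul_assoc,
        hxdn, mul_smul_comm, ← mul_assoc d, ← pow_succ', smul_smul, mul_assoc a, add_assoc,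
        ← add_smul]
      congr 2; ring
  have hcomm : ∀ y : 𝔸, x * y = 0 → ∀ n : ℕ, d ^ n * (a * y) = a * (d ^ n * y) := by
    intro y hy n
    cases n with
    | zero => simp
    | succ n =>
      rw [← mul_assoc, hdna, add_mul, smul_mul_assoc, mul_assoc _ x, hy, mul_zero, smul_zero,
        add_zero, mul_assoc]
  have hmain : ∀ n m : ℕ, d ^ (n + 1) * a ^ (m + 1) = a ^ (m + 1) * d ^ (n + 1)
      + ((q ^ (m + 1) - 1) * (q ^ (n + 1) - 1) / (q - 1)) • (a ^ m * (d ^ n * x)) := by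
    intro n m
    induction m with
    | zero =>
      rw [zero_add, pow_one, hdna, pow_one, mul_div_right_comm, div_self hq1', one_mul, pow_zero,
        one_mul]
    | succ m ih =>
      rw [pow_succ a (m + 1), ← mul_assoc, ih, add_mul, smul_mul_assoc, mul_assoc _ _ a, hdna,
        mul_assoc _ _ a, mul_assoc _ _ a, hxa, mul_smul_comm, hcomm x hxx, mul_smul_comm,
        ← mul_assoc (a ^ m), ← pow_succ, mul_add, mul_smul_comm, smul_smul, add_assoc,
        ← add_smul, ← mul_assoc]
      congr 2; field_simp; ring
  have hsq : ∀ n : ℕ, d ^ n * ((a * a - d * d) * c) = (a * a - d * d) * (d ^ n * c) := by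
    intro n
    have hxac : x * (a * c) = 0 := by
      rw [← mul_assoc, hxa, smul_mul_assoc, mul_assoc, hxc, mul_zero, smul_zero]
    rw [sub_mul, sub_mul, mul_sub, mul_assoc a a, hcomm _ hxac, hcomm _ hxc]
    congr 1
    · simp only [mul_assoc]
    · simp only [← mul_assoc]
      congr 1
      rw [mul_assoc, ← pow_two, ← pow_add, ← pow_add, add_comm]
  have H1 : ∀ k n m p : ℕ, a ^ k * d ^ (n + 1) * (a ^ (m + 1) * d ^ p) =
      a ^ (k + (m + 1)) * d ^ (n + 1 + p) +
      (q ^ p * ((q ^ (m + 1) - 1) * (q ^ (n + 1) - 1) / (q - 1))) •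
        (a ^ (k + m) * (d ^ (n + p) * x)) := by
    intro k n m p
    rw [mul_assoc, ← mul_assoc (d ^ (n + 1)), hmain, add_mul, mul_add, smul_mul_assoc,
      mul_smul_comm, mul_assoc (a ^ m), mul_assoc (d ^ n), hxdn, mul_smul_comm, mul_smul_comm,
      mul_smul_comm, smul_smul, mul_comm (q ^ p)]
    simp only [pow_add, mul_assoc]
  have H2 : ∀ k n m p : ℕ, a ^ k * d ^ (n + 1) * (a ^ (m + 1) * d ^ p * b) =
      a ^ (k + (m + 1)) * d ^ (n + 1 + p) * b +
      (r * q ^ 2 / (q ^ 2 - 1) * q ^ p * (q ^ (m + 1) - 1) * (q ^ (n + 1) - 1)) •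
        (a ^ (k + m) * (a ^ 2 - d ^ 2) * d ^ (n + p) * c) := by
    intro k n m p
    rw [← mul_assoc, H1, add_mul, smul_mul_assoc, mul_assoc _ _ b, mul_assoc _ _ b, mul_assoc _ x b, hxb,
      mul_smul_comm, hsq, mul_smul_comm, smul_smul, pow_two a, pow_two d]
    simp only [mul_assoc]
    congr 2
    have : q ^ 2 - 1 ≠ 0 := by
      have := mul_ne_zero hq1' hqm'
      intro h; apply this; linear_combination h
    rw [show q ^ 2 - 1 = (q - 1) * (1 + q) by ring]
    field_simp
  intro k l k' l' hk hl hk' hl'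
  obtain ⟨n, rfl⟩ : ∃ n, l = n + 1 := ⟨l - 1, by omega⟩
  obtain ⟨m, rfl⟩ : ∃ m, k' = m + 1 := ⟨k' - 1, by omega⟩
  have t1 : k + (m + 1) - 1 = k + m := by omega
  have t2 : n + 1 + l' - 1 = n + l' := by omega
  rw [t1, t2]
  refine ⟨?_, H2 k n m l', ?_, ?_⟩
  · rw [H1, hx]; simp only [mul_assoc]
  · rw [← mul_assoc, H1, add_mul, smul_mul_assoc, mul_assoc _ _ c, mul_assoc _ _ c,
      mul_assoc _ _ c, hxc]
    simp [mul_assoc]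
  · rw [← mul_assoc, H2, add_mul, smul_mul_assoc, mul_assoc _ c c, h8, mul_zero, smul_zero,
      add_zero]
end

section
/- For all integers k, l, k', l' ≥ 1 the following reordering formulae hold in 𝔸: (i) aᵏdˡb·aᵏ'dˡ' = (−1)ˡ'·aᵏ⁺ᵏ'dˡ⁺ˡ'b + (−1)ˡ'·(r·q²/(q²−1))·qˡ'(qᵏ'−1)(qˡ−1)·aᵏ⁺ᵏ'⁻¹(a²−d²)dˡ⁺ˡ'⁻¹c − (−1)ˡ'·(r·q/(q−1))·(qˡ'−1)·aᵏ⁺ᵏ'⁺¹dˡ⁺ˡ'⁻¹c − (−1)ˡ'·(r·qˡ'⁺¹/(q−1))·(qᵏ'−1)·aᵏ⁺ᵏ'⁻¹dˡ⁺ˡ'⁺¹c; (ii) aᵏdˡc·aᵏ'dˡ' = (−1)ˡ'·qᵏ'⁺ˡ'·aᵏ⁺ᵏ'dˡ⁺ˡ'c; (iii) aᵏdˡbc·aᵏ'dˡ' = qᵏ'⁺ˡ'·aᵏ⁺ᵏ'dˡ⁺ˡ'bc. -/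
/-- Reordering formulae (Lemma 2, part 2) in the quantum supergroup algebra `A₁,₂`. -/
theorem reorder_A12_part2
    (r q : ℂ) (hq : q ≠ 0) (hq1 : q ≠ 1) (hqm1 : q ≠ -1)
    {𝔸 : Type*} [Ring 𝔸] [Algebra ℂ 𝔸] (a b c d : 𝔸)
    (h1 : b * a - a * b + (r * q) • (d * c) = 0)
    (h2 : c * a - q • (a * c) = 0)
    (h3 : b * d + d * b - (r * q) • (a * c) = 0)
    (h4 : c * d + q • (d * c) = 0)
    (h5 : a * d - d * a - (1 - q) • (b * c) = 0)
    (h6 : c * b - q • (b * c) = 0)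
    (h7 : (1 + q) • (b * b) - (r * q) • (a * a - d * d) = 0)
    (h8 : c * c = 0) :
    ∀ k l k' l' : ℕ, 1 ≤ k → 1 ≤ l → 1 ≤ k' → 1 ≤ l' →
      (a ^ k * d ^ l * b * (a ^ k' * d ^ l') =
        ((-1 : ℂ) ^ l') • (a ^ (k + k') * d ^ (l + l') * b)
        + ((-1 : ℂ) ^ l' * (r * q ^ 2 / (q ^ 2 - 1)) * q ^ l' * (q ^ k' - 1) * (q ^ l - 1)) •
            (a ^ (k + k' - 1) * (a ^ 2 - d ^ 2) * d ^ (l + l' - 1) * c)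
        - ((-1 : ℂ) ^ l' * (r * q / (q - 1)) * (q ^ l' - 1)) •
            (a ^ (k + k' + 1) * d ^ (l + l' - 1) * c)
        - ((-1 : ℂ) ^ l' * (r * q ^ (l' + 1) / (q - 1)) * (q ^ k' - 1)) •
            (a ^ (k + k' - 1) * d ^ (l + l' + 1) * c))
      ∧ (a ^ k * d ^ l * c * (a ^ k' * d ^ l') =
          ((-1 : ℂ) ^ l' * q ^ (k' + l')) • (a ^ (k + k') * d ^ (l + l') * c))
      ∧ (a ^ k * d ^ l * b * c * (a ^ k' * d ^ l') =
          (q ^ (k' + l') : ℂ) • (a ^ (k + k') * d ^ (l + l') * b * c)) := by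
  have hqm : q - 1 ≠ 0 := sub_ne_zero.mpr hq1
  have hqp : q + 1 ≠ 0 := fun h => hqm1 (eq_neg_of_add_eq_zero_left h)
  have hqp' : 1 + q ≠ 0 := by rwa [add_comm]
  have hq2 : q ^ 2 - 1 ≠ 0 := by
    have : q ^ 2 - 1 = (q - 1) * (q + 1) := by ring
    rw [this]; exact mul_ne_zero hqm hqp
  have ba : b * a = a * b - (r * q) • (d * c) := by
    rw [← sub_eq_zero, ← h1]; abel
  have ca : c * a = q • (a * c) := sub_eq_zero.mp h2
  have bd : b * d = (r * q) • (a * c) - d * b := by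
    rw [← sub_eq_zero, ← h3]; abel
  have cd : c * d = (-q) • (d * c) := by
    rw [neg_smul]; exact eq_neg_of_add_eq_zero_left h4
  have da : d * a = a * d + (q - 1) • (b * c) := by
    rw [← sub_eq_zero, ← neg_eq_zero, ← h5]; module
  have cb : c * b = q • (b * c) := sub_eq_zero.mp h6
  have bb : b * b = (r * q / (1 + q)) • (a * a - d * d) := by
    have h := sub_eq_zero.mp h7
    have h' := congrArg (fun x => (1 + q)⁻¹ • x) h
    simp only [smul_smul, inv_mul_cancel₀ hqp', one_smul] at h'
    rw [h']; congr 1; field_simp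
  have bca : b * c * a = q • (a * (b * c)) := by
    rw [mul_assoc, ca, mul_smul_comm, ← mul_assoc, ba, sub_mul, smul_mul_assoc, mul_assoc d c c,
      h8, mul_assoc]; simp
  have bcd : b * c * d = q • (d * (b * c)) := by
    rw [mul_assoc, cd, mul_smul_comm, ← mul_assoc, bd, sub_mul, smul_mul_assoc, mul_assoc a c c,
      h8, mul_assoc]; simp
  have bcc : b * c * c = 0 := by rw [mul_assoc, h8, mul_zero]
  have bcbc : b * c * (b * c) = 0 := by
    rw [mul_assoc, ← mul_assoc c b c, cb, smul_mul_assoc, mul_assoc b c c, h8]; simp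
  have mv : ∀ (x y : 𝔸) (s : ℂ), x * y = s • (y * x) → ∀ n : ℕ, x * y ^ n = s ^ n • (y ^ n * x) := by
    intro x y s h n
    induction n with
    | zero => simp
    | succ n ih =>
      rw [pow_succ y, ← mul_assoc, ih, smul_mul_assoc, mul_assoc, h, mul_smul_comm, smul_smul,
        ← mul_assoc, pow_succ]
  have can := mv c a q ca
  have cdn := mv c d (-q) cd
  have bcan := mv (b * c) a q bca
  have bcdn := mv (b * c) d q bcd
  have mv2 : ∀ i j : ℕ, b * c * (a ^ i * d ^ j) = q ^ (i + j) • (a ^ i * d ^ j * (b * c)) := by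
    intro i j
    rw [← mul_assoc, bcan, smul_mul_assoc, mul_assoc, bcdn, mul_smul_comm, smul_smul, pow_add,
      mul_assoc]
  have cmv2 : ∀ i j : ℕ, c * (a ^ i * d ^ j) = ((-1) ^ j * q ^ (i + j)) • (a ^ i * d ^ j * c) := by
    intro i j
    rw [← mul_assoc, can, smul_mul_assoc, mul_assoc, cdn, mul_smul_comm, smul_smul, pow_add,
      mul_assoc, neg_pow q]
    congr 1; ring
  have comm1 : ∀ e : 𝔸, b * c * e = 0 → ∀ m j : ℕ,
      d * (a ^ m * (d ^ j * e)) = a ^ m * (d ^ (j + 1) * e) := by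
    intro e he m j
    induction m with
    | zero => simp [pow_succ', mul_assoc]
    | succ m ih =>
      have hz : b * c * (a ^ m * (d ^ j * e)) = 0 := by
        rw [← mul_assoc (a ^ m), ← mul_assoc (b * c), mv2, smul_mul_assoc, mul_assoc, he]; simp
      rw [pow_succ' a, mul_assoc a, ← mul_assoc d a, da, add_mul, smul_mul_assoc, hz, mul_assoc a d,
        ih]
      simp [mul_assoc]
  have comm : ∀ e : 𝔸, b * c * e = 0 → ∀ l m j : ℕ,
      d ^ l * (a ^ m * (d ^ j * e)) = a ^ m * (d ^ (l + j) * e) := by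
    intro e he l m j
    induction l with
    | zero => simp
    | succ l ih =>
      rw [pow_succ' d, mul_assoc, ih, comm1 e he]
      congr 3; ring
  have D1 : ∀ m : ℕ, d * a ^ (m + 1) = a ^ (m + 1) * d + (q ^ (m + 1) - 1) • (a ^ m * (b * c)) := by
    intro m
    induction m with
    | zero => simp [da]
    | succ m ih =>
      rw [pow_succ a (m + 1), ← mul_assoc, ih, add_mul, mul_assoc _ d a, da, smul_mul_assoc,
        mul_assoc (a ^ m), bca, mul_smul_comm, ← mul_assoc (a ^ m) a, ← pow_succ, mul_add,
        mul_smul_comm, mul_assoc (a ^ (m + 1)) a d]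
      module
  have D2 : ∀ n m : ℕ, d ^ (n + 1) * a ^ (m + 1) = a ^ (m + 1) * d ^ (n + 1)
      + ((q ^ (m + 1) - 1) * (q ^ (n + 1) - 1) / (q - 1)) • (a ^ m * (d ^ n * (b * c))) := by
    intro n m
    induction n with
    | zero =>
      have : (q ^ (m + 1) - 1) * (q ^ (0 + 1) - 1) / (q - 1) = q ^ (m + 1) - 1 := by
        field_simp; ring
      rw [this]; simp [D1]
    | succ n ih =>
      rw [pow_succ' d (n + 1), mul_assoc, ih, mul_add, mul_smul_comm, comm1 _ bcbc, ← mul_assoc d,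
        D1, add_mul, smul_mul_assoc, mul_assoc (a ^ m), bcdn, mul_smul_comm,
        mul_assoc _ d, add_assoc, smul_smul, ← add_smul]
      congr 2
      field_simp; ring
  have B1 : ∀ m : ℕ, b * a ^ (m + 1) = a ^ (m + 1) * b
      - (r * q * (q ^ (m + 1) - 1) / (q - 1)) • (a ^ m * (d * c)) := by
    intro m
    induction m with
    | zero =>
      have : r * q * (q ^ (0 + 1) - 1) / (q - 1) = r * q := by field_simp; ring
      rw [this]; simp [ba]
    | succ m ih =>
      have e1 : a ^ m * (d * c) * a = q • (a ^ (m + 1) * (d * c)) := by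
        have := comm1 c bcc 1 0
        simp only [pow_one, pow_zero, one_mul, zero_add] at this
        rw [mul_assoc, mul_assoc, ca, mul_smul_comm, this, mul_smul_comm, ← mul_assoc (a ^ m) a,
          ← pow_succ]
      rw [pow_succ a (m + 1), ← mul_assoc, ih, sub_mul, mul_assoc _ b a, ba, smul_mul_assoc, e1,
        mul_sub, mul_smul_comm, mul_assoc (a ^ (m + 1)) a b, smul_smul, sub_sub, ← add_smul]
      congr 2
      field_simp; ring
  have B2 : ∀ n : ℕ, b * d ^ (n + 1) = (-1 : ℂ) ^ (n + 1) • (d ^ (n + 1) * b)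
      - ((-1) ^ (n + 1) * (r * q * (q ^ (n + 1) - 1) / (q - 1))) • (a * (d ^ n * c)) := by
    intro n
    induction n with
    | zero =>
      have : r * q * (q ^ (0 + 1) - 1) / (q - 1) = r * q := by field_simp; ring
      rw [this]; simp [bd]; abel
    | succ n ih =>
      have e1 : a * (d ^ n * c) * d = (-q) • (a * (d ^ (n + 1) * c)) := by
        rw [mul_assoc, mul_assoc, cd, mul_smul_comm, mul_smul_comm, ← mul_assoc (d ^ n) d,
          ← pow_succ]
      have e2 : d ^ (n + 1) * (a * c) = a * (d ^ (n + 1) * c) := by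
        simpa using comm c bcc (n + 1) 1 0
      rw [pow_succ d (n + 1), ← mul_assoc, ih, sub_mul, smul_mul_assoc, mul_assoc _ b d, bd,
        smul_mul_assoc, e1, mul_sub, mul_smul_comm, e2, mul_assoc (d ^ (n + 1)) d b]
      have hS : r * q * (q ^ (n + 1 + 1) - 1) / (q - 1)
          = r * q + q * (r * q * (q ^ (n + 1) - 1) / (q - 1)) := by field_simp; ring
      rw [hS]
      generalize r * q * (q ^ (n + 1) - 1) / (q - 1) = S
      module
  have key : ∀ m n : ℕ, b * (a ^ (m + 1) * d ^ (n + 1)) =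
      (-1 : ℂ) ^ (n + 1) • (a ^ (m + 1) * (d ^ (n + 1) * b))
      - ((-1) ^ (n + 1) * (r * q * (q ^ (n + 1) - 1) / (q - 1))) • (a ^ (m + 2) * (d ^ n * c))
      - (r * q * (q ^ (m + 1) - 1) / (q - 1) * (-q) ^ (n + 1)) • (a ^ m * (d ^ (n + 2) * c)) := by
    intro m n
    rw [← mul_assoc, B1, sub_mul, mul_assoc _ b, B2, smul_mul_assoc, mul_assoc (a ^ m), mul_assoc d,
      cdn, mul_sub, mul_smul_comm, mul_smul_comm, mul_smul_comm, mul_smul_comm, ← mul_assoc d,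
      ← pow_succ', ← mul_assoc _ a, ← pow_succ, smul_smul]
  have bcb : b * c * b = (q * (r * q / (1 + q))) • ((a ^ 2 - d ^ 2) * c) := by
    rw [mul_assoc, cb, mul_smul_comm, ← mul_assoc, bb, smul_mul_assoc, smul_smul, pow_two, pow_two]
  intro k l k' l' hk hl hk' hl'
  obtain ⟨m, rfl⟩ : ∃ m, k' = m + 1 := ⟨k' - 1, by omega⟩
  obtain ⟨n, rfl⟩ : ∃ n, l' = n + 1 := ⟨l' - 1, by omega⟩
  obtain ⟨p, rfl⟩ : ∃ p, l = p + 1 := ⟨l - 1, by omega⟩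
  refine ⟨?_, ?_, ?_⟩
  · have i1 : k + (m + 1) - 1 = k + m := by omega
    have i2 : p + 1 + (n + 1) - 1 = p + (n + 1) := by omega
    rw [i1, i2]
    have t1 : d ^ (p + 1) * (a ^ (m + 2) * (d ^ n * c)) = a ^ (m + 2) * (d ^ (p + (n + 1)) * c) := by
      rw [comm c bcc, show p + 1 + n = p + (n + 1) by omega]
    have t2 : d ^ (p + 1) * (a ^ m * (d ^ (n + 2) * c))
        = a ^ m * (d ^ (p + 1 + (n + 1) + 1) * c) := by
      rw [comm c bcc]; rfl
    have sq : d ^ (n + 1) * ((a ^ 2 - d ^ 2) * c) = (a ^ 2 - d ^ 2) * (d ^ (n + 1) * c) := by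
      have := comm c bcc (n + 1) 2 0
      simp only [pow_zero, one_mul, add_zero] at this
      rw [sub_mul, sub_mul, mul_sub, this, ← mul_assoc (d ^ (n + 1)), ← mul_assoc (d ^ 2),
        ← pow_add, ← pow_add, add_comm 2]
    have sq2 : d ^ p * ((a ^ 2 - d ^ 2) * (d ^ (n + 1) * c))
        = (a ^ 2 - d ^ 2) * (d ^ (p + (n + 1)) * c) := by
      rw [sub_mul, sub_mul, mul_sub, comm c bcc]
      simp only [← mul_assoc, ← pow_add]
      congr 3; ring
    have t3 : d ^ (p + 1) * (a ^ (m + 1) * (d ^ (n + 1) * b)) =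
        a ^ (m + 1) * (d ^ (p + 1 + (n + 1)) * b)
        + ((q ^ (m + 1) - 1) * (q ^ (p + 1) - 1) / (q - 1) * (q ^ (n + 1) * (q * (r * q / (1 + q)))))
          • (a ^ m * ((a ^ 2 - d ^ 2) * (d ^ (p + (n + 1)) * c))) := by
      rw [← mul_assoc, D2, add_mul, smul_mul_assoc, mul_assoc (a ^ m), mul_assoc (d ^ p),
        ← mul_assoc (b * c), bcdn, smul_mul_assoc, mul_assoc _ (b * c), bcb, mul_smul_comm _ (d ^ (n + 1)),
        sq, mul_smul_comm _ (d ^ p), mul_smul_comm _ (d ^ p), sq2, mul_smul_comm, mul_smul_comm,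
        smul_smul, smul_smul, mul_assoc (a ^ (m + 1)),
        ← mul_assoc (d ^ (p + 1)), ← pow_add,
        mul_assoc ((q ^ (m + 1) - 1) * (q ^ (p + 1) - 1) / (q - 1))]
    rw [mul_assoc, mul_assoc, key, mul_sub (d ^ (p + 1)), mul_sub (d ^ (p + 1)), mul_smul_comm,
      mul_smul_comm _ (d ^ (p + 1)), mul_smul_comm _ (d ^ (p + 1)), t1, t2, t3]
    generalize a ^ 2 - d ^ 2 = z
    have i3 : k + (m + 1) + 1 = k + (m + 2) := by omega
    rw [i3, pow_add a k, pow_add a k, pow_add a k]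
    simp only [mul_sub (a ^ k), mul_add (a ^ k), mul_smul_comm, smul_add, smul_smul,
      mul_assoc (G := 𝔸)]
    have hc1 : (-1 : ℂ) ^ (n + 1) * ((q ^ (m + 1) - 1) * (q ^ (p + 1) - 1) / (q - 1)
        * (q ^ (n + 1) * (q * (r * q / (1 + q))))) = (-1 : ℂ) ^ (n + 1) * (r * q ^ 2 / (q ^ 2 - 1))
        * q ^ (n + 1) * (q ^ (m + 1) - 1) * (q ^ (p + 1) - 1) := by
      have : q ^ 2 - 1 = (q - 1) * (1 + q) := by ring
      rw [this]; field_simp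
    have hc2 : r * q * (q ^ (m + 1) - 1) / (q - 1) * (-q) ^ (n + 1)
        = (-1 : ℂ) ^ (n + 1) * (r * q ^ (n + 1 + 1) / (q - 1)) * (q ^ (m + 1) - 1) := by
      rw [neg_pow q]; field_simp; ring
    have hc3 : (-1 : ℂ) ^ (n + 1) * (r * q * (q ^ (n + 1) - 1) / (q - 1))
        = (-1 : ℂ) ^ (n + 1) * (r * q / (q - 1)) * (q ^ (n + 1) - 1) := by
      field_simp
    rw [hc1, hc2, hc3]
  · have := comm c bcc (p + 1) (m + 1) (n + 1)
    rw [mul_assoc _ c, cmv2, mul_smul_comm]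
    congr 1
    rw [mul_assoc (a ^ k), mul_assoc (a ^ (m + 1)), this, pow_add a k]
    simp only [mul_assoc]
  · have := comm (b * c) bcbc (p + 1) (m + 1) (n + 1)
    rw [mul_assoc _ b c, mul_assoc _ (b * c), mv2, mul_smul_comm]
    congr 1
    rw [mul_assoc (a ^ k), mul_assoc (a ^ (m + 1)), this, pow_add a k]
    simp only [mul_assoc]
end

section
/- For all integers k, l, k', l' ≥ 1 the following reordering formulae hold in 𝔸: (i) aᵏdˡb·aᵏ'dˡ'b = (−1)ˡ'·(r·q/(q+1))·aᵏ⁺ᵏ'(a²−d²)dˡ⁺ˡ' + (−1)ˡ'·r·q·(qˡ⁺ˡ'−1)·aᵏ⁺ᵏ'⁺¹dˡ⁺ˡ'⁻¹bc − (−1)ˡ'·(r·q²/(q−1))·(qˡ'−1)·aᵏ⁺ᵏ'⁺¹dˡ⁺ˡ'⁻¹bc − (−1)ˡ'·(r·q²/(q−1))·qˡ'(qᵏ'−1)·aᵏ⁺ᵏ'⁻¹dˡ⁺ˡ'⁺¹bc + (−1)ˡ'·(r·q³/(q²−1))·qˡ'(qᵏ'−1)(qˡ−1)·aᵏ⁺ᵏ'⁻¹(a²−d²)dˡ⁺ˡ'⁻¹bc;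 (ii) aᵏdˡb·aᵏ'dˡ'c = (−1)ˡ'·aᵏ⁺ᵏ'dˡ⁺ˡ'bc; (iii) aᵏdˡc·aᵏ'dˡ'b = (−1)ˡ'·qᵏ'⁺ˡ'⁺¹·aᵏ⁺ᵏ'dˡ⁺ˡ'bc; (iv) aᵏdˡb·aᵏ'dˡ'bc = (−1)ˡ'·(r·q/(q+1))·aᵏ⁺ᵏ'(a²−d²)dˡ⁺ˡ'c; (v) aᵏdˡbc·aᵏ'dˡ'b = (r·q²/(q+1))·qᵏ'⁺ˡ'·aᵏ⁺ᵏ'(a²−d²)dˡ⁺ˡ'c; (vi) aᵏdˡc·aᵏ'dˡ'c = aᵏdˡc·aᵏ'dˡ'bc = aᵏdˡbc·aᵏ'dˡ'c = aᵏdˡbc·aᵏ'dˡ'bc = 0. -/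
/-- Reordering formulae (Lemma 2, part 3) in the quantum supergroup algebra `A₁,₂`. -/
theorem reorder_A12_part3
    (r q : ℂ) (hq : q ≠ 0) (hq1 : q ≠ 1) (hqm1 : q ≠ -1)
    {𝔸 : Type*} [Ring 𝔸] [Algebra ℂ 𝔸] (a b c d : 𝔸)
    (h1 : b * a - a * b + (r * q) • (d * c) = 0)
    (h2 : c * a - q • (a * c) = 0)
    (h3 : b * d + d * b - (r * q) • (a * c) = 0)
    (h4 : c * d + q • (d * c) = 0)
    (h5 : a * d - d * a - (1 - q) • (b * c) = 0)
    (h6 : c * b - q • (b * c) = 0)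
    (h7 : (1 + q) • (b * b) - (r * q) • (a * a - d * d) = 0)
    (h8 : c * c = 0) :
    ∀ k l k' l' : ℕ, 1 ≤ k → 1 ≤ l → 1 ≤ k' → 1 ≤ l' →
      (a ^ k * d ^ l * b * (a ^ k' * d ^ l' * b) =
        ((-1 : ℂ) ^ l' * (r * q / (q + 1))) • (a ^ (k + k') * (a ^ 2 - d ^ 2) * d ^ (l + l'))
        + ((-1 : ℂ) ^ l' * r * q * (q ^ (l + l') - 1)) •
            (a ^ (k + k' + 1) * d ^ (l + l' - 1) * b * c)
        - ((-1 : ℂ) ^ l' * (r * q ^ 2 / (q - 1)) * (q ^ l' - 1)) •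
            (a ^ (k + k' + 1) * d ^ (l + l' - 1) * b * c)
        - ((-1 : ℂ) ^ l' * (r * q ^ 2 / (q - 1)) * q ^ l' * (q ^ k' - 1)) •
            (a ^ (k + k' - 1) * d ^ (l + l' + 1) * b * c)
        + ((-1 : ℂ) ^ l' * (r * q ^ 3 / (q ^ 2 - 1)) * q ^ l' * (q ^ k' - 1) * (q ^ l - 1)) •
            (a ^ (k + k' - 1) * (a ^ 2 - d ^ 2) * d ^ (l + l' - 1) * b * c))
      ∧ (a ^ k * d ^ l * b * (a ^ k' * d ^ l' * c) =
          ((-1 : ℂ) ^ l') • (a ^ (k + k') * d ^ (l + l') * b * c))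
      ∧ (a ^ k * d ^ l * c * (a ^ k' * d ^ l' * b) =
          ((-1 : ℂ) ^ l' * q ^ (k' + l' + 1)) • (a ^ (k + k') * d ^ (l + l') * b * c))
      ∧ (a ^ k * d ^ l * b * (a ^ k' * d ^ l' * b * c) =
          ((-1 : ℂ) ^ l' * (r * q / (q + 1))) •
            (a ^ (k + k') * (a ^ 2 - d ^ 2) * d ^ (l + l') * c))
      ∧ (a ^ k * d ^ l * b * c * (a ^ k' * d ^ l' * b) =
          ((r * q ^ 2 / (q + 1)) * q ^ (k' + l')) •
            (a ^ (k + k') * (a ^ 2 - d ^ 2) * d ^ (l + l') * c))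
      ∧ (a ^ k * d ^ l * c * (a ^ k' * d ^ l' * c) = 0)
      ∧ (a ^ k * d ^ l * c * (a ^ k' * d ^ l' * b * c) = 0)
      ∧ (a ^ k * d ^ l * b * c * (a ^ k' * d ^ l' * c) = 0)
      ∧ (a ^ k * d ^ l * b * c * (a ^ k' * d ^ l' * b * c) = 0) := by
  have hq1' : q - 1 ≠ 0 := sub_ne_zero.mpr hq1
  have hqm' : q + 1 ≠ 0 := fun h => hqm1 (eq_neg_of_add_eq_zero_left h)
  have hqq : q ^ 2 - 1 ≠ 0 := by
    have : q ^ 2 - 1 = (q - 1) * (q + 1) := by ring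
    rw [this]; exact mul_ne_zero hq1' hqm'
  -- rewriting forms of the relations
  have ba : b * a = a * b - (r * q) • (d * c) := by
    rw [← sub_eq_zero, ← h1]; abel
  have ca : c * a = q • (a * c) := sub_eq_zero.mp h2
  have bd : b * d = -(d * b) + (r * q) • (a * c) := by
    rw [← sub_eq_zero, ← h3]; abel
  have cd : c * d = (-q) • (d * c) := by
    rw [neg_smul]; exact eq_neg_of_add_eq_zero_left h4
  have da : d * a = a * d - (1 - q) • (b * c) := by
    rw [← sub_eq_zero, ← neg_eq_zero, ← h5]; abel
  have cb : c * b = q • (b * c) := sub_eq_zero.mp h6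
  have bb : b * b = (r * q / (q + 1)) • (a ^ 2 - d ^ 2) := by
    have h : (1 + q) • (b * b) = (r * q) • (a * a - d * d) := sub_eq_zero.mp h7
    have h' : b * b = (1 + q)⁻¹ • ((1 + q) • (b * b)) := by
      rw [smul_smul, inv_mul_cancel₀ (by rwa [add_comm]), one_smul]
    rw [h', h, smul_smul, pow_two, pow_two]
    congr 1
    rw [add_comm 1 q]; field_simp
  -- left annihilator facts
  have Ka : ∀ x : 𝔸, c * x = 0 → c * (a * x) = 0 := fun x hx => by
    rw [← mul_assoc, ca, smul_mul_assoc, mul_assoc, hx, mul_zero, smul_zero]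
  have Kd : ∀ x : 𝔸, c * x = 0 → c * (d * x) = 0 := fun x hx => by
    rw [← mul_assoc, cd, smul_mul_assoc, mul_assoc, hx, mul_zero, smul_zero]
  have Kb : ∀ x : 𝔸, c * x = 0 → c * (b * x) = 0 := fun x hx => by
    rw [← mul_assoc, cb, smul_mul_assoc, mul_assoc, hx, mul_zero, smul_zero]
  have Kan : ∀ (n : ℕ) (x : 𝔸), c * x = 0 → c * (a ^ n * x) = 0 := by
    intro n
    induction n with
    | zero => intro x hx; simpa using hx
    | succ n ih => intro x hx; rw [pow_succ, mul_assoc]; exact ih _ (Ka x hx)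
  have Kdn : ∀ (n : ℕ) (x : 𝔸), c * x = 0 → c * (d ^ n * x) = 0 := by
    intro n
    induction n with
    | zero => intro x hx; simpa using hx
    | succ n ih => intro x hx; rw [pow_succ, mul_assoc]; exact ih _ (Kd x hx)
  have C1 : ∀ x : 𝔸, c * x = 0 → d * (a * x) = a * (d * x) := fun x hx => by
    rw [← mul_assoc, da, sub_mul, smul_mul_assoc, mul_assoc b, hx, mul_zero, smul_zero, sub_zero,
      mul_assoc]
  have C2 : ∀ (n : ℕ) (x : 𝔸), c * x = 0 → d * (a ^ n * x) = a ^ n * (d * x) := by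
    intro n
    induction n with
    | zero => intro x hx; simp
    | succ n ih =>
      intro x hx
      rw [pow_succ, mul_assoc, ih _ (Ka x hx), C1 x hx, mul_assoc]
  have C3 : ∀ (m n : ℕ) (x : 𝔸), c * x = 0 → d ^ m * (a ^ n * x) = a ^ n * (d ^ m * x) := by
    intro m
    induction m with
    | zero => intro n x hx; simp
    | succ m ih =>
      intro n x hx
      rw [pow_succ, mul_assoc, C2 n x hx, ih n _ (Kd x hx), mul_assoc]
  have can : ∀ n : ℕ, c * a ^ n = q ^ n • (a ^ n * c) := by
    intro n
    induction n with
    | zero => simp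
    | succ n ih =>
      rw [pow_succ a, ← mul_assoc, ih, smul_mul_assoc, mul_assoc, ca, mul_smul_comm, smul_smul,
        ← pow_succ, mul_assoc]
  have cdn : ∀ n : ℕ, c * d ^ n = (-q) ^ n • (d ^ n * c) := by
    intro n
    induction n with
    | zero => simp
    | succ n ih =>
      rw [pow_succ d, ← mul_assoc, ih, smul_mul_assoc, mul_assoc, cd, mul_smul_comm, smul_smul,
        ← pow_succ, mul_assoc]
  have Kc : c * (b * c) = 0 := Kb c h8
  have bca : b * c * a = q • (a * (b * c)) := by
    rw [mul_assoc, ca, mul_smul_comm, ← mul_assoc, ba, sub_mul, smul_mul_assoc, mul_assoc d, h8,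
      mul_zero, smul_zero, sub_zero, mul_assoc]
  have bcd : b * c * d = q • (d * (b * c)) := by
    rw [mul_assoc, cd, mul_smul_comm, ← mul_assoc, bd, add_mul, smul_mul_assoc, mul_assoc a, h8,
      mul_zero, smul_zero, add_zero, neg_mul, neg_smul, smul_neg, neg_neg, mul_assoc]
  have bcan : ∀ n : ℕ, b * c * a ^ n = q ^ n • (a ^ n * (b * c)) := by
    intro n
    induction n with
    | zero => simp
    | succ n ih =>
      rw [pow_succ a, ← mul_assoc, ih, smul_mul_assoc, mul_assoc, bca, mul_smul_comm, smul_smul,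
        ← pow_succ, mul_assoc]
  have bcdn : ∀ n : ℕ, b * c * d ^ n = q ^ n • (d ^ n * (b * c)) := by
    intro n
    induction n with
    | zero => simp
    | succ n ih =>
      rw [pow_succ d, ← mul_assoc, ih, smul_mul_assoc, mul_assoc, bcd, mul_smul_comm, smul_smul,
        ← pow_succ, mul_assoc]
  have ban : ∀ n : ℕ, b * a ^ (n + 1) =
      a ^ (n + 1) * b - (r * q * ((q ^ (n + 1) - 1) / (q - 1))) • (a ^ n * (d * c)) := by
    intro n
    induction n with
    | zero =>
      simp [ba, div_self hq1']
    | succ n ih =>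
      have e : d * c * a = q • (a * (d * c)) := by
        rw [mul_assoc, ca, mul_smul_comm, C1 c h8]
      rw [pow_succ a (n + 1), ← mul_assoc, ih, sub_mul, smul_mul_assoc, mul_assoc, ba,
        mul_assoc (a ^ n), e, mul_sub, mul_smul_comm, mul_smul_comm, smul_smul,
        ← mul_assoc (a ^ n) a, ← pow_succ, ← mul_assoc (a ^ (n + 1)) a, sub_sub, ← add_smul]
      congr 2
      field_simp
      ring
  have bdn : ∀ n : ℕ, b * d ^ (n + 1) = ((-1 : ℂ) ^ (n + 1)) • (d ^ (n + 1) * b) +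
      ((-1 : ℂ) ^ n * (r * q * ((q ^ (n + 1) - 1) / (q - 1)))) • (a * (d ^ n * c)) := by
    intro n
    induction n with
    | zero =>
      simp [bd, div_self hq1']
    | succ n ih =>
      have e : a * (d ^ n * c) * d = (-q) • (a * (d ^ (n + 1) * c)) := by
        rw [mul_assoc, mul_assoc, cd, mul_smul_comm, mul_smul_comm, ← mul_assoc (d ^ n),
          ← pow_succ]
      have e2 : d ^ (n + 1) * (a * c) = a * (d ^ (n + 1) * c) := by
        simpa using C3 (n + 1) 1 c h8
      rw [pow_succ d (n + 1), ← mul_assoc, ih, add_mul, smul_mul_assoc, smul_mul_assoc, e,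
        mul_assoc, bd, mul_add, mul_smul_comm, e2, mul_neg, smul_add, smul_neg, smul_smul,
        smul_smul, ← mul_assoc (d ^ (n + 1)) d, add_assoc, ← add_smul, ← neg_smul]
      congr 2
      · ring
      · field_simp
        ring
  -- moving powers of `d` through powers of `a`
  have dna : ∀ l : ℕ, d ^ (l + 1) * a = a * d ^ (l + 1) + (q ^ (l + 1) - 1) • (d ^ l * (b * c)) := by
    intro l
    induction l with
    | zero =>
      simp only [zero_add, pow_one, pow_zero, one_mul, da]
      module
    | succ l ih =>
      rw [pow_succ d (l + 1), mul_assoc, da, mul_sub, ← mul_assoc, ih, add_mul, smul_mul_assoc,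
        mul_assoc (d ^ l), bcd, mul_smul_comm, mul_smul_comm, smul_smul, ← mul_assoc (d ^ l) d,
        ← pow_succ, mul_assoc a, add_sub_assoc, ← sub_smul]
      congr 2
      ring
  have dnan : ∀ l n : ℕ, d ^ (l + 1) * a ^ (n + 1) = a ^ (n + 1) * d ^ (l + 1) +
      ((q ^ (l + 1) - 1) * ((q ^ (n + 1) - 1) / (q - 1))) • (a ^ n * (d ^ l * (b * c))) := by
    intro l n
    induction n with
    | zero => simp [dna, div_self hq1']
    | succ n ih =>
      have e : d ^ l * (b * c) * a = q • (a * (d ^ l * (b * c))) := by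
        have := C3 l 1 _ Kc
        rw [pow_one] at this
        rw [mul_assoc, bca, mul_smul_comm, this]
      rw [pow_succ a (n + 1), ← mul_assoc, ih, add_mul, smul_mul_assoc, mul_assoc, dna,
        mul_assoc (a ^ n), e, mul_add, mul_smul_comm, mul_smul_comm, smul_smul,
        ← mul_assoc (a ^ n) a, ← pow_succ, ← mul_assoc (a ^ (n + 1)) a, add_assoc, ← add_smul]
      congr 2
      field_simp
      ring
  intro k l k' l' hk hl hk' hl'
  obtain ⟨k, rfl⟩ := Nat.exists_eq_add_of_le' hk
  obtain ⟨l, rfl⟩ := Nat.exists_eq_add_of_le' hl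
  obtain ⟨m, rfl⟩ := Nat.exists_eq_add_of_le' hk'
  obtain ⟨n, rfl⟩ := Nat.exists_eq_add_of_le' hl'
  -- the product `b * a ^ _ * d ^ _ * x` for `x` killed by `c`
  have Bx : ∀ x : 𝔸, c * x = 0 → b * (a ^ (m + 1) * (d ^ (n + 1) * x)) =
      ((-1 : ℂ) ^ (n + 1)) • (a ^ (m + 1) * (d ^ (n + 1) * (b * x))) := by
    intro x hx
    rw [← mul_assoc, ban, sub_mul, smul_mul_assoc, mul_assoc (a ^ m), mul_assoc d,
      Kdn _ _ hx, mul_zero, mul_zero, smul_zero, sub_zero, mul_assoc, ← mul_assoc b, bdn, add_mul,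
      smul_mul_assoc, smul_mul_assoc, mul_assoc a, mul_assoc _ c, hx, mul_zero, mul_zero,
      smul_zero, add_zero, mul_smul_comm, mul_assoc]
  -- combining `a ^ i d ^ j a ^ i' d ^ j' x`
  have Mx : ∀ (i j i' j' : ℕ) (x : 𝔸), c * x = 0 →
      a ^ i * (d ^ j * (a ^ i' * (d ^ j' * x))) = a ^ (i + i') * (d ^ (j + j') * x) := by
    intro i j i' j' x hx
    rw [C3 _ _ _ (Kdn _ _ hx), ← mul_assoc, ← pow_add, ← mul_assoc (d ^ j), ← pow_add]
  have Sx : ∀ (j : ℕ) (x : 𝔸), c * x = 0 →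
      d ^ j * ((a ^ 2 - d ^ 2) * x) = (a ^ 2 - d ^ 2) * (d ^ j * x) := by
    intro j x hx
    rw [sub_mul, mul_sub, C3 _ _ _ hx, sub_mul, ← mul_assoc (d ^ j), ← mul_assoc (d ^ 2),
      ← pow_add, ← pow_add, add_comm j 2]
  have Kz : ∀ x : 𝔸, c * x = 0 → c * (a ^ (m + 1) * (d ^ (n + 1) * x)) = 0 :=
    fun x hx => Kan _ _ (Kdn _ _ hx)
  have KS : ∀ x : 𝔸, c * x = 0 → c * ((a ^ 2 - d ^ 2) * x) = 0 := fun x hx => by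
    rw [sub_mul, mul_sub, Kan _ _ hx, Kdn _ _ hx, sub_zero]
  have cad : c * (a ^ (m + 1) * (d ^ (n + 1) * b)) =
      ((-1 : ℂ) ^ (n + 1) * q ^ (m + 1 + (n + 1) + 1)) •
        (a ^ (m + 1) * (d ^ (n + 1) * (b * c))) := by
    rw [← mul_assoc, can, smul_mul_assoc, mul_assoc, ← mul_assoc c, cdn, smul_mul_assoc,
      mul_assoc _ c, cb, mul_smul_comm, mul_smul_comm, mul_smul_comm, smul_smul, smul_smul]
    congr 1
    rw [neg_pow]; ring
  refine ⟨?_, ?_, ?_, ?_, ?_, ?_, ?_, ?_, ?_⟩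
  · have e1 : b * (a ^ (m + 1) * (d ^ (n + 1) * b)) =
        ((-1 : ℂ) ^ (n + 1) * (r * q / (q + 1))) •
          (a ^ (m + 1) * (d ^ (n + 1) * (a ^ 2 - d ^ 2)))
        + ((-1 : ℂ) ^ n * (r * q * ((q ^ (n + 1) - 1) / (q - 1))) * q) •
          (a ^ (m + 2) * (d ^ n * (b * c)))
        - ((r * q * ((q ^ (m + 1) - 1) / (q - 1))) * ((-q) ^ (n + 1) * q)) •
          (a ^ m * (d ^ (n + 2) * (b * c))) := by
      have e2 : c * (d ^ (n + 1) * b) = ((-q) ^ (n + 1) * q) • (d ^ (n + 1) * (b * c)) := by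
        rw [← mul_assoc, cdn, smul_mul_assoc, mul_assoc _ c, cb, mul_smul_comm, smul_smul]
      rw [← mul_assoc, ban, sub_mul, smul_mul_assoc, mul_assoc (a ^ m), mul_assoc d, e2,
        mul_smul_comm, mul_smul_comm, smul_smul, ← mul_assoc d, ← pow_succ', mul_assoc _ b,
        ← mul_assoc b, bdn, add_mul, smul_mul_assoc, smul_mul_assoc, mul_assoc (d ^ (n + 1)) b, bb,
        mul_assoc a, mul_assoc (d ^ n) c, cb, mul_smul_comm, mul_smul_comm, mul_smul_comm,
        mul_add, mul_smul_comm, mul_smul_comm, mul_smul_comm, mul_smul_comm, smul_smul, smul_smul,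
        ← mul_assoc (a ^ (m + 1)) a, ← pow_succ]
    have e3 : a ^ (k + 1) * (d ^ (l + 1) * (a ^ (m + 1) * (d ^ (n + 1) * (a ^ 2 - d ^ 2)))) =
        a ^ (k + 1 + (m + 1)) * ((a ^ 2 - d ^ 2) * d ^ (l + 1 + (n + 1)))
        + ((q ^ (l + 1 + (n + 1)) - 1) * (q + 1)) •
          (a ^ (k + m + 3) * (d ^ (l + n + 1) * (b * c)))
        + ((q ^ (l + 1) - 1) * ((q ^ (m + 1) - 1) / (q - 1)) * q ^ (n + 3)) •
          (a ^ (k + m + 1) * ((a ^ 2 - d ^ 2) * (d ^ (l + n + 1) * (b * c)))) := by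
      have f1 : d ^ (l + n + 1 + 1) * (a ^ 2 - d ^ 2) = (a ^ 2 - d ^ 2) * d ^ (l + n + 1 + 1)
          + ((q ^ (l + n + 1 + 1) - 1) * (q + 1)) • (a * (d ^ (l + n + 1) * (b * c))) := by
        have f := dnan (l + n + 1) 1
        have g : (q ^ (1 + 1) - 1) / (q - 1) = q + 1 := by
          field_simp; ring
        rw [g, pow_one] at f
        rw [mul_sub, f, sub_mul (a ^ 2), ← pow_add d, ← pow_add d, add_comm 2 (l + n + 1 + 1)]
        abel
      have f2 : b * c * (a ^ 2 - d ^ 2) = q ^ 2 • ((a ^ 2 - d ^ 2) * (b * c)) := by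
        rw [mul_sub, bcan, bcdn, sub_mul, smul_sub]
      have f3 : b * c * (d ^ (n + 1) * (a ^ 2 - d ^ 2)) =
          q ^ (n + 3) • ((a ^ 2 - d ^ 2) * (d ^ (n + 1) * (b * c))) := by
        rw [← mul_assoc, bcdn, smul_mul_assoc, mul_assoc, f2, mul_smul_comm, Sx _ _ Kc, smul_smul]
        congr 1
        ring
      rw [← mul_assoc (d ^ (l + 1)), dnan, add_mul, smul_mul_assoc, mul_assoc (a ^ m),
        mul_assoc (d ^ l), f3, mul_smul_comm, mul_smul_comm, smul_smul,
        Sx _ _ (Kdn _ _ Kc), ← mul_assoc (d ^ l), ← pow_add, mul_assoc (a ^ (m + 1)),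
        ← mul_assoc (d ^ (l + 1)), ← pow_add, show l + 1 + (n + 1) = l + n + 1 + 1 by ring, f1,
        mul_add, mul_add, mul_add, mul_smul_comm, mul_smul_comm, mul_smul_comm,
        ← mul_assoc (a ^ (m + 1)) a, ← pow_succ, ← mul_assoc (a ^ (k + 1)),
        ← mul_assoc (a ^ (k + 1)), ← mul_assoc (a ^ (k + 1)), ← pow_add, ← pow_add, ← pow_add,
        show k + 1 + (m + 1 + 1) = k + m + 3 by ring, show k + 1 + m = k + m + 1 by ring,
        show l + (n + 1) = l + n + 1 by ring]
    have L : a ^ (k + 1) * d ^ (l + 1) * b * (a ^ (m + 1) * d ^ (n + 1) * b) =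
        a ^ (k + 1) * (d ^ (l + 1) * (b * (a ^ (m + 1) * (d ^ (n + 1) * b)))) := by
      simp only [mul_assoc]
    rw [L, e1]
    simp only [mul_add, mul_sub (d ^ (l + 1)), mul_sub (a ^ (k + 1)), mul_smul_comm]
    rw [Mx _ _ _ _ _ Kc, Mx _ _ _ _ _ Kc, e3]
    rw [show k + 1 + (m + 1) + 1 = k + m + 3 by ring, show l + 1 + (n + 1) - 1 = l + n + 1 by lia,
      show k + 1 + (m + 1) - 1 = k + m + 1 by lia, show k + 1 + (m + 2) = k + m + 3 by ring,
      show l + 1 + n = l + n + 1 by ring, show k + 1 + m = k + m + 1 by ring,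
      show l + 1 + (n + 2) = l + 1 + (n + 1) + 1 by ring]
    simp only [mul_assoc (a ^ _), mul_assoc (d ^ _), mul_assoc (a ^ 2 - d ^ 2), neg_pow q]
    have hq3 : q ^ 2 - 1 = (q - 1) * (q + 1) := by ring
    rw [hq3]
    match_scalars <;> field_simp <;> ring
  · have := Bx c h8
    simp only [mul_assoc] at this ⊢
    rw [this, mul_smul_comm, mul_smul_comm, Mx _ _ _ _ _ Kc]
  · simp only [mul_assoc]
    rw [cad, mul_smul_comm, mul_smul_comm, Mx _ _ _ _ _ Kc]
  · simp only [mul_assoc]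
    rw [Bx _ Kc, ← mul_assoc b, bb, smul_mul_assoc]
    simp only [mul_smul_comm]
    rw [Mx _ _ _ _ _ (KS c h8), smul_smul, Sx _ _ h8]
  · have e : b * (a ^ (m + 1) * (d ^ (n + 1) * (b * c))) = _ := Bx _ Kc
    simp only [mul_assoc]
    rw [cad, mul_smul_comm, e, ← mul_assoc b, bb, smul_mul_assoc]
    simp only [mul_smul_comm]
    rw [Mx _ _ _ _ _ (KS c h8), smul_smul, smul_smul, Sx _ _ h8]
    congr 1
    have s : (-1 : ℂ) ^ (n + 1) * (-1) ^ (n + 1) = 1 := by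
      rw [← mul_pow]; simp
    linear_combination (r * q / (q + 1)) * q ^ (m + 1 + (n + 1) + 1) * s
  · simp only [mul_assoc]
    rw [Kz c h8, mul_zero, mul_zero]
  · simp only [mul_assoc]
    rw [Kz _ Kc, mul_zero, mul_zero]
  · simp only [mul_assoc]
    rw [Kz c h8, mul_zero, mul_zero, mul_zero]
  · simp only [mul_assoc]
    rw [Kz _ Kc, mul_zero, mul_zero, mul_zero]
end

section
/- For all natural numbers k, l the following reordering formulae hold in 𝔸: (b + c)·aᵏdˡ = (r·a − s·d)ᵏ·(s·a − r·d)ˡ·(b + c) and (b − c)·aᵏdˡ = (r·a + s·d)ᵏ·(−s·a − r·d)ˡ·(b − c) (the powers are well defined since a and d commute); equivalently, b·aᵏdˡ = ½[(r·a − s·d)ᵏ(s·a − r·d)ˡ(b + c) + (r·a + s·d)ᵏ(−s·a − r·d)ˡ(b − c)] and c·aᵏdˡ = ½[(r·a − s·d)ᵏ(s·a − r·d)ˡ(b + c) − (r·a + s·d)ᵏ(−s·a − r·d)ˡ(b − c)]. -/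
/-- Reordering formulae in the quantum supergroup algebra `A₁,₁`:
`(b ± c)·aᵏdˡ = (r·a ∓ s·d)ᵏ(±s·a − r·d)ˡ(b ± c)`, and the equivalent expressions
for `b·aᵏdˡ` and `c·aᵏdˡ`. -/
theorem reorder_A11
    (r s : ℂ)
    {𝔸 : Type*} [Ring 𝔸] [Algebra ℂ 𝔸] (a b c d : 𝔸)
    (h1 : b * a - r • (a * b) + s • (d * c) = 0)
    (h2 : c * a - r • (a * c) + s • (d * b) = 0)
    (h3 : b * d + r • (d * b) - s • (a * c) = 0)
    (h4 : c * d + r • (d * c) - s • (a * b) = 0)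
    (h5 : a * d - d * a = 0)
    (h6 : b * c - c * b = 0)
    (h7 : b * b = (s / 2) • (a * a - d * d))
    (h8 : c * c = (s / 2) • (a * a - d * d)) :
    ∀ k l : ℕ,
      ((b + c) * (a ^ k * d ^ l) =
        (r • a - s • d) ^ k * (s • a - r • d) ^ l * (b + c))
      ∧ ((b - c) * (a ^ k * d ^ l) =
        (r • a + s • d) ^ k * (-(s • a) - r • d) ^ l * (b - c))
      ∧ (b * (a ^ k * d ^ l) =
        (1 / 2 : ℂ) • ((r • a - s • d) ^ k * (s • a - r • d) ^ l * (b + c)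
          + (r • a + s • d) ^ k * (-(s • a) - r • d) ^ l * (b - c)))
      ∧ (c * (a ^ k * d ^ l) =
        (1 / 2 : ℂ) • ((r • a - s • d) ^ k * (s • a - r • d) ^ l * (b + c)
          - (r • a + s • d) ^ k * (-(s • a) - r • d) ^ l * (b - c))) := by
  have e1 : b * a = r • (a * b) - s • (d * c) := by
    rw [← sub_eq_zero, ← h1]; abel
  have e2 : c * a = r • (a * c) - s • (d * b) := by
    rw [← sub_eq_zero, ← h2]; abel
  have e3 : b * d = s • (a * c) - r • (d * b) := by
    rw [← sub_eq_zero, ← h3]; abel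
  have e4 : c * d = s • (a * b) - r • (d * c) := by
    rw [← sub_eq_zero, ← h4]; abel
  have pa : SemiconjBy (b + c) a (r • a - s • d) := by
    simp only [SemiconjBy, add_mul, sub_mul, mul_add, smul_mul_assoc, e1, e2, smul_add]
    abel
  have pd : SemiconjBy (b + c) d (s • a - r • d) := by
    simp only [SemiconjBy, add_mul, sub_mul, mul_add, smul_mul_assoc, e3, e4, smul_add]
    abel
  have ma : SemiconjBy (b - c) a (r • a + s • d) := by
    simp only [SemiconjBy, add_mul, sub_mul, mul_sub, smul_mul_assoc, e1, e2, smul_sub]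
    abel
  have md : SemiconjBy (b - c) d (-(s • a) - r • d) := by
    simp only [SemiconjBy, neg_mul, sub_mul, mul_sub, smul_mul_assoc, e3, e4, smul_sub]
    abel
  intro k l
  have P := ((pa.pow_right k).mul_right (pd.pow_right l)).eq
  have M := ((ma.pow_right k).mul_right (md.pow_right l)).eq
  refine ⟨P, M, ?_, ?_⟩
  · rw [← P, ← M, ← add_mul, ← smul_mul_assoc]
    congr 1
    module
  · rw [← P, ← M, ← sub_mul, ← smul_mul_assoc]
    congr 1
    module
end
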